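/- Let L be a language, R a polarized rewrite system in L, and L' the language obtained by adding an equality symbol in each sort of L. Then a sequent Γ ⊢ Δ of L is provable modulo R if and only if it is provable in predicate logic from U_R, where U_R consists of the axioms of equality for L', the universal closure of t = u for each equational axiom t = u of E, the universal closure of P ⇒ A for each rule P → A of R₋, and the universal closure of A ⇒ P for each rule P → A of R₊. -/

import Mathlib

namespace PDM

open Classical

noncomputable section

/-- A many-sorted first-order language. -/
structure Language : Type 1 where
  Sorts : Type
  Func : Type
  arity : Func → List Sorts
  ret : Func → Sorts
  Pred : Type
  parity : Pred → List Sorts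

variable {L : Language}

/-- Well-sorted terms, with (per-sort de Bruijn style) variables. -/
inductive Term (L : Language) : L.Sorts → Type where
  | var {s : L.Sorts} (n : ℕ) : Term L s
  | func (f : L.Func)
      (args : (i : Fin (L.arity f).length) → Term L ((L.arity f).get i)) :
      Term L (L.ret f)

def Term.rename (ρ : (s : L.Sorts) → ℕ → ℕ) :
    (s : L.Sorts) → Term L s → Term L s
  | s, .var n => .var (ρ s n)
  | _, .func f args => .func f fun i => Term.rename ρ _ (args i)

def Term.subst (σ : (s : L.Sorts) → ℕ → Term L s) :
    (s : L.Sorts) → Term L s → Term L s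
  | s, .var n => σ s n
  | _, .func f args => .func f fun i => Term.subst σ _ (args i)

/-- Shift up the variables of sort `s₀`. -/
def shiftRen (s₀ : L.Sorts) : (s : L.Sorts) → ℕ → ℕ :=
  fun s n => if s = s₀ then n + 1 else n

/-- Push a renaming under a binder of sort `s₀`. -/
def liftRen (s₀ : L.Sorts) (ρ : (s : L.Sorts) → ℕ → ℕ) : (s : L.Sorts) → ℕ → ℕ :=
  fun s n =>
    if s = s₀ then
      match n with
      | 0 => 0
      | n + 1 => ρ s n + 1
    else ρ s n

/-- Push a substitution under a binder of sort `s₀`. -/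
def liftSubst (s₀ : L.Sorts) (σ : (s : L.Sorts) → ℕ → Term L s) :
    (s : L.Sorts) → ℕ → Term L s :=
  fun s n =>
    if s = s₀ then
      match n with
      | 0 => .var 0
      | n + 1 => Term.rename (shiftRen s₀) s (σ s n)
    else Term.rename (shiftRen s₀) s (σ s n)

/-- First-order propositions over `L`. -/
inductive Form (L : Language) : Type where
  | pred (p : L.Pred)
      (args : (i : Fin (L.parity p).length) → Term L ((L.parity p).get i)) : Form L
  | bot : Form L
  | top : Form L
  | not (A : Form L) : Form L
  | and (A B : Form L) : Form L
  | or (A B : Form L) : Form L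
  | imp (A B : Form L) : Form L
  | all (s : L.Sorts) (A : Form L) : Form L
  | ex (s : L.Sorts) (A : Form L) : Form L

def Form.rename : ((s : L.Sorts) → ℕ → ℕ) → Form L → Form L
  | ρ, .pred p args => .pred p fun i => Term.rename ρ _ (args i)
  | _, .bot => .bot
  | _, .top => .top
  | ρ, .not A => .not (Form.rename ρ A)
  | ρ, .and A B => .and (Form.rename ρ A) (Form.rename ρ B)
  | ρ, .or A B => .or (Form.rename ρ A) (Form.rename ρ B)
  | ρ, .imp A B => .imp (Form.rename ρ A) (Form.rename ρ B)
  | ρ, .all s A => .all s (Form.rename (liftRen s ρ) A)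
  | ρ, .ex s A => .ex s (Form.rename (liftRen s ρ) A)

def Form.subst : ((s : L.Sorts) → ℕ → Term L s) → Form L → Form L
  | σ, .pred p args => .pred p fun i => Term.subst σ _ (args i)
  | _, .bot => .bot
  | _, .top => .top
  | σ, .not A => .not (Form.subst σ A)
  | σ, .and A B => .and (Form.subst σ A) (Form.subst σ B)
  | σ, .or A B => .or (Form.subst σ A) (Form.subst σ B)
  | σ, .imp A B => .imp (Form.subst σ A) (Form.subst σ B)
  | σ, .all s A => .all s (Form.subst (liftSubst s σ) A)
  | σ, .ex s A => .ex s (Form.subst (liftSubst s σ) A)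

/-- Shift up the free variables of sort `s₀` in a proposition. -/
def Form.shift (s₀ : L.Sorts) (A : Form L) : Form L :=
  Form.rename (shiftRen s₀) A

/-- The substitution replacing the free variable `0` of sort `s` by `t`
(and shifting the other variables of sort `s` down). -/
def subst0 {s : L.Sorts} (t : Term L s) : (s' : L.Sorts) → ℕ → Term L s' :=
  fun s' n =>
    if h : s = s' then
      match n with
      | 0 => h ▸ t
      | n + 1 => .var n
    else .var n

/-- Instantiation of the body of a quantifier over sort `s` with a term `t`. -/
def Form.inst {s : L.Sorts} (t : Term L s) (A : Form L) : Form L :=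
  Form.subst (subst0 t) A

def Form.IsAtomic : Form L → Prop
  | .pred _ _ => True
  | _ => False

/-- A polarized rewrite system: equations between terms, and negative and
positive proposition rewrite rules whose left-hand sides are atomic. -/
structure PRS (L : Language) : Type 1 where
  eqns : (s : L.Sorts) → Term L s → Term L s → Prop
  neg : Form L → Form L → Prop
  pos : Form L → Form L → Prop
  neg_atomic : ∀ {P A : Form L}, neg P A → P.IsAtomic
  pos_atomic : ∀ {P A : Form L}, pos P A → P.IsAtomic

/-- The congruence on terms generated by the equations. -/
inductive EqE (rs : PRS L) : (s : L.Sorts) → Term L s → Term L s → Prop where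
  | base {s : L.Sorts} {t u : Term L s} (σ : (s : L.Sorts) → ℕ → Term L s) :
      rs.eqns s t u → EqE rs s (Term.subst σ s t) (Term.subst σ s u)
  | refl {s : L.Sorts} (t : Term L s) : EqE rs s t t
  | symm {s : L.Sorts} {t u : Term L s} : EqE rs s t u → EqE rs s u t
  | trans {s : L.Sorts} {t u v : Term L s} :
      EqE rs s t u → EqE rs s u v → EqE rs s t v
  | congr (f : L.Func)
      {args args' : (i : Fin (L.arity f).length) → Term L ((L.arity f).get i)}
      (h : ∀ i, EqE rs _ (args i) (args' i)) :
      EqE rs (L.ret f) (.func f args) (.func f args')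

mutual
  /-- One step negative rewriting. -/
  inductive RwNeg (rs : PRS L) : Form L → Form L → Prop where
    | predArg (p : L.Pred)
        (args args' : (i : Fin (L.parity p).length) → Term L ((L.parity p).get i))
        (i : Fin (L.parity p).length) :
        EqE rs _ (args i) (args' i) → (∀ j, j ≠ i → args j = args' j) →
        RwNeg rs (.pred p args) (.pred p args')
    | rule {P A : Form L} (σ : (s : L.Sorts) → ℕ → Term L s) :
        rs.neg P A → RwNeg rs (Form.subst σ P) (Form.subst σ A)
    | notC {A A' : Form L} : RwPos rs A A' → RwNeg rs (.not A) (.not A')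
    | andL {A A' B : Form L} : RwNeg rs A A' → RwNeg rs (.and A B) (.and A' B)
    | andR {A B B' : Form L} : RwNeg rs B B' → RwNeg rs (.and A B) (.and A B')
    | orL {A A' B : Form L} : RwNeg rs A A' → RwNeg rs (.or A B) (.or A' B)
    | orR {A B B' : Form L} : RwNeg rs B B' → RwNeg rs (.or A B) (.or A B')
    | impL {A A' B : Form L} : RwPos rs A A' → RwNeg rs (.imp A B) (.imp A' B)
    | impR {A B B' : Form L} : RwNeg rs B B' → RwNeg rs (.imp A B) (.imp A B')
    | allC {s : L.Sorts} {A A' : Form L} :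
        RwNeg rs A A' → RwNeg rs (.all s A) (.all s A')
    | exC {s : L.Sorts} {A A' : Form L} :
        RwNeg rs A A' → RwNeg rs (.ex s A) (.ex s A')
  /-- One step positive rewriting. -/
  inductive RwPos (rs : PRS L) : Form L → Form L → Prop where
    | predArg (p : L.Pred)
        (args args' : (i : Fin (L.parity p).length) → Term L ((L.parity p).get i))
        (i : Fin (L.parity p).length) :
        EqE rs _ (args i) (args' i) → (∀ j, j ≠ i → args j = args' j) →
        RwPos rs (.pred p args) (.pred p args')
    | rule {P A : Form L} (σ : (s : L.Sorts) → ℕ → Term L s) :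
        rs.pos P A → RwPos rs (Form.subst σ P) (Form.subst σ A)
    | notC {A A' : Form L} : RwNeg rs A A' → RwPos rs (.not A) (.not A')
    | andL {A A' B : Form L} : RwPos rs A A' → RwPos rs (.and A B) (.and A' B)
    | andR {A B B' : Form L} : RwPos rs B B' → RwPos rs (.and A B) (.and A B')
    | orL {A A' B : Form L} : RwPos rs A A' → RwPos rs (.or A B) (.or A' B)
    | orR {A B B' : Form L} : RwPos rs B B' → RwPos rs (.or A B) (.or A B')
    | impL {A A' B : Form L} : RwNeg rs A A' → RwPos rs (.imp A B) (.imp A' B)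
    | impR {A B B' : Form L} : RwPos rs B B' → RwPos rs (.imp A B) (.imp A B')
    | allC {s : L.Sorts} {A A' : Form L} :
        RwPos rs A A' → RwPos rs (.all s A) (.all s A')
    | exC {s : L.Sorts} {A A' : Form L} :
        RwPos rs A A' → RwPos rs (.ex s A) (.ex s A')
end

/-- Reflexive-transitive closure of negative rewriting: `A →₋* B`. -/
def RwNegS (rs : PRS L) : Form L → Form L → Prop := Relation.ReflTransGen (RwNeg rs)

/-- Reflexive-transitive closure of positive rewriting: `A →₊* B`. -/
def RwPosS (rs : PRS L) : Form L → Form L → Prop := Relation.ReflTransGen (RwPos rs)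

/-- One step rewriting of sequents. -/
inductive SeqRw (rs : PRS L) :
    Multiset (Form L) × Multiset (Form L) → Multiset (Form L) × Multiset (Form L) →
    Prop where
  | left {Γ Δ : Multiset (Form L)} {A A' : Form L} :
      RwNeg rs A A' → SeqRw rs (A ::ₘ Γ, Δ) (A' ::ₘ Γ, Δ)
  | right {Γ Δ : Multiset (Form L)} {A A' : Form L} :
      RwPos rs A A' → SeqRw rs (Γ, A ::ₘ Δ) (Γ, A' ::ₘ Δ)
/-- Polarized sequent calculus modulo `rs`.  `Pf rs useCut n Γ Δ` means that the
sequent `Γ ⊢ Δ` has a proof of size `n`, using the cut rule only if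
`useCut = true`. -/
inductive Pf (rs : PRS L) (useCut : Bool) :
    ℕ → Multiset (Form L) → Multiset (Form L) → Prop where
  | ax {A B P : Form L} :
      Form.IsAtomic P → RwNegS rs A P → RwPosS rs B P →
      Pf rs useCut 1 {A} {B}
  | cut {Γ Δ : Multiset (Form L)} {A B C : Form L} {n m : ℕ} :
      useCut = true → RwNegS rs A B → RwPosS rs A C →
      Pf rs useCut n (B ::ₘ Γ) Δ → Pf rs useCut m Γ (C ::ₘ Δ) →
      Pf rs useCut (n + m + 1) Γ Δ
  | contrL {Γ Δ : Multiset (Form L)} {A B C : Form L} {n : ℕ} :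
      RwNegS rs A B → RwNegS rs A C →
      Pf rs useCut n (B ::ₘ C ::ₘ Γ) Δ → Pf rs useCut (n + 1) (A ::ₘ Γ) Δ
  | contrR {Γ Δ : Multiset (Form L)} {A B C : Form L} {n : ℕ} :
      RwPosS rs A B → RwPosS rs A C →
      Pf rs useCut n Γ (B ::ₘ C ::ₘ Δ) → Pf rs useCut (n + 1) Γ (A ::ₘ Δ)
  | weakL {Γ Δ : Multiset (Form L)} {A : Form L} {n : ℕ} :
      Pf rs useCut n Γ Δ → Pf rs useCut (n + 1) (A ::ₘ Γ) Δ
  | weakR {Γ Δ : Multiset (Form L)} {A : Form L} {n : ℕ} :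
      Pf rs useCut n Γ Δ → Pf rs useCut (n + 1) Γ (A ::ₘ Δ)
  | topR {Γ Δ : Multiset (Form L)} {A : Form L} :
      RwPosS rs A .top → Pf rs useCut 1 Γ (A ::ₘ Δ)
  | botL {Γ Δ : Multiset (Form L)} {A : Form L} :
      RwNegS rs A .bot → Pf rs useCut 1 (A ::ₘ Γ) Δ
  | notL {Γ Δ : Multiset (Form L)} {A B : Form L} {n : ℕ} :
      RwNegS rs A (.not B) →
      Pf rs useCut n Γ (B ::ₘ Δ) → Pf rs useCut (n + 1) (A ::ₘ Γ) Δ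
  | notR {Γ Δ : Multiset (Form L)} {A B : Form L} {n : ℕ} :
      RwPosS rs A (.not B) →
      Pf rs useCut n (B ::ₘ Γ) Δ → Pf rs useCut (n + 1) Γ (A ::ₘ Δ)
  | andL {Γ Δ : Multiset (Form L)} {A B C : Form L} {n : ℕ} :
      RwNegS rs A (.and B C) →
      Pf rs useCut n (B ::ₘ C ::ₘ Γ) Δ → Pf rs useCut (n + 1) (A ::ₘ Γ) Δ
  | andR {Γ Δ : Multiset (Form L)} {A B C : Form L} {n m : ℕ} :
      RwPosS rs A (.and B C) →
      Pf rs useCut n Γ (B ::ₘ Δ) → Pf rs useCut m Γ (C ::ₘ Δ) →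
      Pf rs useCut (n + m + 1) Γ (A ::ₘ Δ)
  | orL {Γ Δ : Multiset (Form L)} {A B C : Form L} {n m : ℕ} :
      RwNegS rs A (.or B C) →
      Pf rs useCut n (B ::ₘ Γ) Δ → Pf rs useCut m (C ::ₘ Γ) Δ →
      Pf rs useCut (n + m + 1) (A ::ₘ Γ) Δ
  | orR {Γ Δ : Multiset (Form L)} {A B C : Form L} {n : ℕ} :
      RwPosS rs A (.or B C) →
      Pf rs useCut n Γ (B ::ₘ C ::ₘ Δ) → Pf rs useCut (n + 1) Γ (A ::ₘ Δ)
  | impL {Γ Δ : Multiset (Form L)} {A B C : Form L} {n m : ℕ} :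
      RwNegS rs A (.imp B C) →
      Pf rs useCut n Γ (B ::ₘ Δ) → Pf rs useCut m (C ::ₘ Γ) Δ →
      Pf rs useCut (n + m + 1) (A ::ₘ Γ) Δ
  | impR {Γ Δ : Multiset (Form L)} {A B C : Form L} {n : ℕ} :
      RwPosS rs A (.imp B C) →
      Pf rs useCut n (B ::ₘ Γ) (C ::ₘ Δ) → Pf rs useCut (n + 1) Γ (A ::ₘ Δ)
  | allL {Γ Δ : Multiset (Form L)} {s : L.Sorts} {t : Term L s} {A B C : Form L}
      {n : ℕ} :
      RwNegS rs A (.all s B) → RwNegS rs (Form.inst t B) C →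
      Pf rs useCut n (C ::ₘ Γ) Δ → Pf rs useCut (n + 1) (A ::ₘ Γ) Δ
  | allR {Γ Δ : Multiset (Form L)} {s : L.Sorts} {A B : Form L} {n : ℕ} :
      RwPosS rs A (.all s B) →
      Pf rs useCut n (Γ.map (Form.shift s)) (B ::ₘ Δ.map (Form.shift s)) →
      Pf rs useCut (n + 1) Γ (A ::ₘ Δ)
  | exL {Γ Δ : Multiset (Form L)} {s : L.Sorts} {A B : Form L} {n : ℕ} :
      RwNegS rs A (.ex s B) →
      Pf rs useCut n (B ::ₘ Γ.map (Form.shift s)) (Δ.map (Form.shift s)) →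
      Pf rs useCut (n + 1) (A ::ₘ Γ) Δ
  | exR {Γ Δ : Multiset (Form L)} {s : L.Sorts} {t : Term L s} {A B C : Form L}
      {n : ℕ} :
      RwPosS rs A (.ex s B) → RwPosS rs (Form.inst t B) C →
      Pf rs useCut n Γ (C ::ₘ Δ) → Pf rs useCut (n + 1) Γ (A ::ₘ Δ)

/-- The sequent `Γ ⊢ Δ` is provable modulo `rs`. -/
def Provable (rs : PRS L) (Γ Δ : Multiset (Form L)) : Prop :=
  ∃ n, Pf rs true n Γ Δ

/-- The sequent `Γ ⊢ Δ` has a cut free proof modulo `rs`. -/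
def CutFreeProvable (rs : PRS L) (Γ Δ : Multiset (Form L)) : Prop :=
  ∃ n, Pf rs false n Γ Δ

/-- The sequent `Γ ⊢ Δ` is provable in the set of axioms `T` modulo `rs`:
some finite multiset of axioms of `T` can be added on the left. -/
def ProvableIn (rs : PRS L) (T : Set (Form L)) (Γ Δ : Multiset (Form L)) : Prop :=
  ∃ T' : Multiset (Form L), (∀ A ∈ T', A ∈ T) ∧ Provable rs (Γ + T') Δ

/-- The empty rewrite system; provability modulo it is ordinary provability in
classical first-order predicate logic. -/
def emptyPRS (L : Language) : PRS L where
  eqns := fun _ _ _ => False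
  neg := fun _ _ => False
  pos := fun _ _ => False
  neg_atomic := fun h => h.elim
  pos_atomic := fun h => h.elim

/-- Provability in predicate logic from a set of axioms `U`. -/
def PLProvableIn (U : Set (Form L)) (Γ Δ : Multiset (Form L)) : Prop :=
  ProvableIn (emptyPRS L) U Γ Δ

/-- Compatibility of the theory `⟨rs, T⟩` with the set of axioms `U`. -/
structure Compatible (rs : PRS L) (T U : Set (Form L)) : Prop where
  rwNeg : ∀ A B : Form L, RwNegS rs A B → PLProvableIn U 0 {Form.imp A B}
  rwPos : ∀ A B : Form L, RwPosS rs A B → PLProvableIn U 0 {Form.imp B A}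
  axT : ∀ A ∈ T, PLProvableIn U 0 {A}
  axU : ∀ A ∈ U, ProvableIn rs T 0 {A}
/-- The list of (sort, index) free variables of a term. -/
def Term.freeList : (s : L.Sorts) → Term L s → List ((s : L.Sorts) × ℕ)
  | s, .var n => [⟨s, n⟩]
  | _, .func f args =>
      (List.finRange (L.arity f).length).flatMap fun i => Term.freeList _ (args i)

/-- Adjusting a list of free variables when leaving a binder of sort `s`. -/
def unbind (s : L.Sorts) (l : List ((s : L.Sorts) × ℕ)) :
    List ((s : L.Sorts) × ℕ) :=
  (l.filter fun v => decide ¬(v.1 = s ∧ v.2 = 0)).map fun v =>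
    if v.1 = s then ⟨v.1, v.2 - 1⟩ else v

/-- The list of (sort, index) free variables of a proposition. -/
def Form.freeList : Form L → List ((s : L.Sorts) × ℕ)
  | .pred p args =>
      (List.finRange (L.parity p).length).flatMap fun i => Term.freeList _ (args i)
  | .bot => []
  | .top => []
  | .not A => A.freeList
  | .and A B => A.freeList ++ B.freeList
  | .or A B => A.freeList ++ B.freeList
  | .imp A B => A.freeList ++ B.freeList
  | .all s A => unbind s A.freeList
  | .ex s A => unbind s A.freeList

/-- Universally quantify over the free variable `k` of sort `s`. -/
def Form.abstractVar (s : L.Sorts) (k : ℕ) (A : Form L) : Form L :=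
  .all s (A.subst fun s' n =>
    if s' = s then (if n = k then .var 0 else .var (n + 1)) else .var n)

def closeSteps : ℕ → Form L → Form L
  | 0, A => A
  | n + 1, A =>
    match A.freeList with
    | [] => A
    | v :: _ => closeSteps n (A.abstractVar v.1 v.2)

/-- The universal closure of a proposition. -/
def univClosure (A : Form L) : Form L := closeSteps A.freeList.length A

/-- The set of axioms `A_R` associated with a polarized rewrite system. -/
def axSetAR (rs : PRS L) : Set (Form L) :=
  {C | ∃ A B : Form L, RwNegS rs A B ∧ C = univClosure (A.imp B)} ∪
  {C | ∃ A B : Form L, RwPosS rs A B ∧ C = univClosure (B.imp A)}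

/-- A (many-sorted, classical) first-order model of the language `L`. -/
structure Model (L : Language) : Type 1 where
  dom : L.Sorts → Type
  inhab : ∀ s, Nonempty (dom s)
  interpF : (f : L.Func) →
      ((i : Fin (L.arity f).length) → dom ((L.arity f).get i)) → dom (L.ret f)
  interpP : (p : L.Pred) →
      ((i : Fin (L.parity p).length) → dom ((L.parity p).get i)) → Prop

/-- Valuations of the variables in a model. -/
def Model.Val (M : Model L) : Type := (s : L.Sorts) → ℕ → M.dom s

/-- Denotation of terms. -/
def Model.evalT (M : Model L) (φ : M.Val) : (s : L.Sorts) → Term L s → M.dom s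
  | s, .var n => φ s n
  | _, .func f args => M.interpF f fun i => M.evalT φ _ (args i)

/-- Pushing a new value for the variable `0` of sort `s` into a valuation. -/
def Model.push (M : Model L) (φ : M.Val) {s : L.Sorts} (d : M.dom s) : M.Val :=
  fun s' n =>
    if h : s = s' then
      match n with
      | 0 => h ▸ d
      | n + 1 => φ s' n
    else φ s' n

/-- Denotation (truth value) of propositions. -/
def Model.evalF (M : Model L) : M.Val → Form L → Prop
  | φ, .pred p args => M.interpP p fun i => M.evalT φ _ (args i)
  | _, .bot => False
  | _, .top => True
  | φ, .not A => ¬ M.evalF φ A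
  | φ, .and A B => M.evalF φ A ∧ M.evalF φ B
  | φ, .or A B => M.evalF φ A ∨ M.evalF φ B
  | φ, .imp A B => M.evalF φ A → M.evalF φ B
  | φ, .all s A => ∀ d : M.dom s, M.evalF (M.push φ d) A
  | φ, .ex s A => ∃ d : M.dom s, M.evalF (M.push φ d) A

/-- A proposition is valid in a model. -/
def Model.ValidForm (M : Model L) (A : Form L) : Prop := ∀ φ : M.Val, M.evalF φ A

/-- A sequent is valid in a model. -/
def Model.ValidSeq (M : Model L) (Γ Δ : Multiset (Form L)) : Prop :=
  ∀ φ : M.Val, (∀ A ∈ Γ, M.evalF φ A) → ∃ B ∈ Δ, M.evalF φ B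

/-- `M` is a model of a set of axioms. -/
def IsModelOf (M : Model L) (S : Set (Form L)) : Prop := ∀ A ∈ S, M.ValidForm A

/-- `M` is a model of the theory `⟨rs, T⟩`, i.e. a model of `A_R ∪ T`. -/
def IsModelOfTheory (M : Model L) (rs : PRS L) (T : Set (Form L)) : Prop :=
  IsModelOf M (axSetAR rs ∪ T)

/-- An equality model: terms congruent modulo `=_E` have the same denotation. -/
def IsEqualityModel (M : Model L) (rs : PRS L) : Prop :=
  ∀ (s : L.Sorts) (t u : Term L s), EqE rs s t u →
    ∀ φ : M.Val, M.evalT φ s t = M.evalT φ s u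

/-- The relation `∼` on a domain of a model: being denotations of two
`=_E`-congruent terms. -/
def simRel (rs : PRS L) (M : Model L) (s : L.Sorts) (a b : M.dom s) : Prop :=
  ∃ (t u : Term L s) (φ : M.Val),
    EqE rs s t u ∧ a = M.evalT φ s t ∧ b = M.evalT φ s u

/-- A literal: an atomic proposition or the negation of an atomic one. -/
def Form.IsLiteral (A : Form L) : Prop :=
  A.IsAtomic ∨ ∃ B : Form L, B.IsAtomic ∧ A = .not B

/-- Disjunctions of literals. -/
inductive IsDisj : Form L → Prop where
  | lit {A : Form L} : A.IsLiteral → IsDisj A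
  | or {A B : Form L} : IsDisj A → IsDisj B → IsDisj (.or A B)

/-- Universally quantified disjunctions of literals. -/
inductive IsQuantClause : Form L → Prop where
  | disj {A : Form L} : IsDisj A → IsQuantClause A
  | all {s : L.Sorts} {A : Form L} : IsQuantClause A → IsQuantClause (.all s A)

/-- A clausal proposition: `⊥` or `∀x₁…∀xₚ (L₁ ∨ … ∨ Lₙ)`. -/
def Form.IsClausal (A : Form L) : Prop := A = .bot ∨ IsQuantClause A

/-- A clausal polarized rewrite system. -/
def IsClausalSystem (rs : PRS L) : Prop :=
  (∀ P A : Form L, rs.neg P A → P.IsAtomic ∧ A.IsClausal) ∧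
  (∀ P A : Form L, rs.pos P A → P.IsAtomic ∧ ∃ B : Form L, B.IsClausal ∧ A = .not B)
/-- The language obtained by adding an equality predicate in each sort. -/
def withEq (L : Language) : Language where
  Sorts := L.Sorts
  Func := L.Func
  arity := L.arity
  ret := L.ret
  Pred := L.Pred ⊕ L.Sorts
  parity := fun p =>
    match p with
    | .inl p => L.parity p
    | .inr s => [s, s]

/-- The canonical embedding of terms of `L` into `withEq L`. -/
def Term.toEq : (s : L.Sorts) → Term L s → Term (withEq L) s
  | _, .var n => .var n
  | _, .func f args =>
      Term.func (L := withEq L) f fun i => Term.toEq _ (args i)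

/-- The canonical embedding of propositions of `L` into `withEq L`. -/
def Form.toEq : Form L → Form (withEq L)
  | .pred p args => Form.pred (L := withEq L) (.inl p) fun i => Term.toEq (L := L) _ (args i)
  | .bot => .bot
  | .top => .top
  | .not A => .not A.toEq
  | .and A B => .and A.toEq B.toEq
  | .or A B => .or A.toEq B.toEq
  | .imp A B => .imp A.toEq B.toEq
  | .all s A => .all s A.toEq
  | .ex s A => .ex s A.toEq

/-- The rewrite system `rs` viewed as a rewrite system of `withEq L`. -/
def PRS.toEq (rs : PRS L) : PRS (withEq L) where
  eqns := fun s t u =>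
    ∃ t₀ u₀ : Term L s, rs.eqns s t₀ u₀ ∧ t = Term.toEq (L := L) s t₀ ∧ u = Term.toEq (L := L) s u₀
  neg := fun P A => ∃ P₀ A₀ : Form L, rs.neg P₀ A₀ ∧ P = P₀.toEq ∧ A = A₀.toEq
  pos := fun P A => ∃ P₀ A₀ : Form L, rs.pos P₀ A₀ ∧ P = P₀.toEq ∧ A = A₀.toEq
  neg_atomic := by
    rintro P A ⟨P₀, A₀, h, rfl, rfl⟩
    have h' := rs.neg_atomic h
    cases P₀ <;> simp_all [Form.IsAtomic, Form.toEq]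
  pos_atomic := by
    rintro P A ⟨P₀, A₀, h, rfl, rfl⟩
    have h' := rs.pos_atomic h
    cases P₀ <;> simp_all [Form.IsAtomic, Form.toEq]

/-- A two-element family of arguments. -/
def args2 {L' : Language} {s₁ s₂ : L'.Sorts} (t : Term L' s₁) (u : Term L' s₂) :
    (i : Fin ([s₁, s₂] : List L'.Sorts).length) →
      Term L' (([s₁, s₂] : List L'.Sorts).get i)
  | ⟨0, _⟩ => t
  | ⟨1, _⟩ => u

/-- A one-element family of arguments. -/
def args1 {L' : Language} {s : L'.Sorts} (t : Term L' s) :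
    (i : Fin ([s] : List L'.Sorts).length) → Term L' (([s] : List L'.Sorts).get i)
  | ⟨0, _⟩ => t

/-- The proposition `t = u` in `withEq L`. -/
def eqForm {s : L.Sorts} (t u : Term (withEq L) s) : Form (withEq L) :=
  .pred (.inr s) (args2 t u)

/-- Hypothesis `x₁ = y₁ ∧ … ∧ xₙ = yₙ` for the congruence axiom of a function
symbol, where `xᵢ` is the variable `2i` and `yᵢ` the variable `2i+1`. -/
def congrHypF (f : L.Func) : Form (withEq L) :=
  (List.finRange (L.arity f).length).foldr
    (fun i C => .and (eqForm (s := (L.arity f).get i)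
      (.var (2 * i.val)) (.var (2 * i.val + 1))) C) .top

/-- The congruence axiom for a function symbol. -/
def funcCongrAx (f : L.Func) : Form (withEq L) :=
  univClosure ((congrHypF f).imp
    (eqForm (Term.func (L := withEq L) f fun i => .var (2 * i.val))
            (Term.func (L := withEq L) f fun i => .var (2 * i.val + 1))))

/-- Hypothesis for the congruence axiom of a predicate symbol of `withEq L`. -/
def congrHypP (p : (withEq L).Pred) : Form (withEq L) :=
  (List.finRange ((withEq L).parity p).length).foldr
    (fun i C => .and (eqForm (s := ((withEq L).parity p).get i)
      (.var (2 * i.val)) (.var (2 * i.val + 1))) C) .top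

/-- The congruence (Leibniz) axiom for a predicate symbol. -/
def predCongrAx (p : (withEq L).Pred) : Form (withEq L) :=
  univClosure ((congrHypP p).imp
    ((Form.pred p fun i => .var (2 * i.val)).imp
      (Form.pred p fun i => .var (2 * i.val + 1))))

/-- The axioms of equality for the language `withEq L`. -/
def EqAxioms (L : Language) : Set (Form (withEq L)) :=
  {C | ∃ s : L.Sorts,
      C = univClosure (eqForm (s := s) (.var 0) (.var 0))} ∪
  {C | ∃ s : L.Sorts,
      C = univClosure ((eqForm (s := s) (.var 0) (.var 1)).imp
        (eqForm (s := s) (.var 1) (.var 0)))} ∪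
  {C | ∃ s : L.Sorts,
      C = univClosure ((Form.and (eqForm (s := s) (.var 0) (.var 1))
        (eqForm (s := s) (.var 1) (.var 2))).imp
          (eqForm (s := s) (.var 0) (.var 2)))} ∪
  {C | ∃ f : L.Func, C = funcCongrAx f} ∪
  {C | ∃ p : (withEq L).Pred, C = predCongrAx p}

/-- The set of axioms `U_R` associated with a polarized rewrite system over a
language with equality. -/
def URset {L₀ : Language} (rs : PRS (withEq L₀)) : Set (Form (withEq L₀)) :=
  EqAxioms L₀ ∪
  {C | ∃ (s : L₀.Sorts) (t u : Term (withEq L₀) s),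
      rs.eqns s t u ∧ C = univClosure (eqForm t u)} ∪
  {C | ∃ P A : Form (withEq L₀), rs.neg P A ∧ C = univClosure (P.imp A)} ∪
  {C | ∃ P A : Form (withEq L₀), rs.pos P A ∧ C = univClosure (A.imp P)}
/-! ### Simple Type Theory: the theories HOL and HOL± -/

/-- Simple types. -/
inductive STy : Type where
  | iota : STy
  | o : STy
  | arr (T U : STy) : STy

/-- The function symbols of HOL. -/
inductive HFunc : Type where
  | K (T U : STy) : HFunc
  | S (T U V : STy) : HFunc
  | dor : HFunc
  | dnot : HFunc
  | dall (T : STy) : HFunc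
  | zero : HFunc
  | succ : HFunc
  | pred : HFunc
  | null : HFunc
  | app (T U : STy) : HFunc

def HFunc.arity : HFunc → List STy
  | .app T U => [.arr T U, T]
  | _ => []

def HFunc.ret : HFunc → STy
  | .K T U => .arr T (.arr U T)
  | .S T U V => .arr (.arr T (.arr U V)) (.arr (.arr T U) (.arr T V))
  | .dor => .arr .o (.arr .o .o)
  | .dnot => .arr .o .o
  | .dall T => .arr (.arr T .o) .o
  | .zero => .iota
  | .succ => .arr .iota .iota
  | .pred => .arr .iota .iota
  | .null => .arr .iota .o
  | .app _ U => U

/-- The language of HOL: sorts are simple types, and `ε` is the unique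
predicate symbol, of rank `⟨o⟩`. -/
def LHOL : Language where
  Sorts := STy
  Func := HFunc
  arity := HFunc.arity
  ret := HFunc.ret
  Pred := Unit
  parity := fun _ => [STy.o]

/-- The language of HOL±: that of HOL plus a symbol `H_T` of sort
`(T → o) → T` for each sort `T`. -/
def LHOLpm : Language where
  Sorts := STy
  Func := HFunc ⊕ STy
  arity := fun f =>
    match f with
    | .inl f => f.arity
    | .inr T => [STy.arr T STy.o]
  ret := fun f =>
    match f with
    | .inl f => f.ret
    | .inr T => T
  Pred := Unit
  parity := fun _ => [STy.o]

/-- Application in HOL. -/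
def hap {T U : STy} (t : Term LHOL (STy.arr T U)) (u : Term LHOL T) :
    Term LHOL U :=
  Term.func (L := LHOL) (HFunc.app T U) (args2 (L' := LHOL) t u)

/-- Application in HOL±. -/
def pap {T U : STy} (t : Term LHOLpm (STy.arr T U)) (u : Term LHOLpm T) :
    Term LHOLpm U :=
  Term.func (L := LHOLpm) (Sum.inl (HFunc.app T U)) (args2 (L' := LHOLpm) t u)

/-- The Hilbert symbol `H_T` applied to a term, in HOL±. -/
def hH (T : STy) (t : Term LHOLpm (STy.arr T STy.o)) : Term LHOLpm T :=
  Term.func (L := LHOLpm) (Sum.inr T) (args1 (L' := LHOLpm) t)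

/-- The constants of HOL. -/
def hK (T U : STy) : Term LHOL (HFunc.ret (.K T U)) :=
  Term.func (L := LHOL) (HFunc.K T U) finZeroElim
def hS (T U V : STy) : Term LHOL (HFunc.ret (.S T U V)) :=
  Term.func (L := LHOL) (HFunc.S T U V) finZeroElim
def hOr : Term LHOL (HFunc.ret .dor) :=
  Term.func (L := LHOL) HFunc.dor finZeroElim
def hNot : Term LHOL (HFunc.ret .dnot) :=
  Term.func (L := LHOL) HFunc.dnot finZeroElim
def hAll (T : STy) : Term LHOL (HFunc.ret (.dall T)) :=
  Term.func (L := LHOL) (HFunc.dall T) finZeroElim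
def hZero : Term LHOL (HFunc.ret .zero) :=
  Term.func (L := LHOL) HFunc.zero finZeroElim
def hSucc : Term LHOL (HFunc.ret .succ) :=
  Term.func (L := LHOL) HFunc.succ finZeroElim
def hPred : Term LHOL (HFunc.ret .pred) :=
  Term.func (L := LHOL) HFunc.pred finZeroElim
def hNull : Term LHOL (HFunc.ret .null) :=
  Term.func (L := LHOL) HFunc.null finZeroElim

/-- The constants of HOL±. -/
def pK (T U : STy) : Term LHOLpm (HFunc.ret (.K T U)) :=
  Term.func (L := LHOLpm) (Sum.inl (HFunc.K T U)) finZeroElim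
def pS (T U V : STy) : Term LHOLpm (HFunc.ret (.S T U V)) :=
  Term.func (L := LHOLpm) (Sum.inl (HFunc.S T U V)) finZeroElim
def pOr : Term LHOLpm (HFunc.ret .dor) :=
  Term.func (L := LHOLpm) (Sum.inl HFunc.dor) finZeroElim
def pNot : Term LHOLpm (HFunc.ret .dnot) :=
  Term.func (L := LHOLpm) (Sum.inl HFunc.dnot) finZeroElim
def pAll (T : STy) : Term LHOLpm (HFunc.ret (.dall T)) :=
  Term.func (L := LHOLpm) (Sum.inl (HFunc.dall T)) finZeroElim
def pZero : Term LHOLpm (HFunc.ret .zero) :=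
  Term.func (L := LHOLpm) (Sum.inl HFunc.zero) finZeroElim
def pSucc : Term LHOLpm (HFunc.ret .succ) :=
  Term.func (L := LHOLpm) (Sum.inl HFunc.succ) finZeroElim
def pPred : Term LHOLpm (HFunc.ret .pred) :=
  Term.func (L := LHOLpm) (Sum.inl HFunc.pred) finZeroElim
def pNull : Term LHOLpm (HFunc.ret .null) :=
  Term.func (L := LHOLpm) (Sum.inl HFunc.null) finZeroElim

/-- The proposition `ε(t)` of HOL. -/
def hEps (t : Term LHOL STy.o) : Form LHOL :=
  Form.pred (L := LHOL) () (args1 (L' := LHOL) t)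

/-- The proposition `ε(t)` of HOL±. -/
def pEps (t : Term LHOLpm STy.o) : Form LHOLpm :=
  Form.pred (L := LHOLpm) () (args1 (L' := LHOLpm) t)

/-- The equations of HOL (and of HOL±), on the language of HOL. -/
inductive HOLEq : (s : STy) → Term LHOL s → Term LHOL s → Prop where
  | Keq (T U : STy) :
      HOLEq T (hap (hap (hK T U) (.var 0)) (.var 1)) (.var 0)
  | Seq (T U V : STy) :
      HOLEq V (hap (hap (hap (hS T U V) (.var 0)) (.var 1)) (.var 2))
        (hap (hap (.var 0) (.var 2)) (hap (.var 1) (.var 2)))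
  | PredSucc :
      HOLEq .iota (hap (hPred) (hap (hSucc) (.var 0))) (.var 0)

/-- The rewrite rules of HOL (used both negatively and positively). -/
inductive HOLRule : Form LHOL → Form LHOL → Prop where
  | orRule :
      HOLRule (hEps (hap (hap (hOr) (.var 0)) (.var 1)))
        (.or (hEps (.var 0)) (hEps (.var 1)))
  | notRule :
      HOLRule (hEps (hap (hNot) (.var 0))) (.not (hEps (.var 0)))
  | allRule (T : STy) :
      HOLRule (hEps (hap (hAll T) (.var 0)))
        (.all T (hEps (hap (.var 0) (.var 0))))
  | nullSucc :
      HOLRule (hEps (hap (hNull) (hap (hSucc) (.var 0)))) .bot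
  | nullZero :
      HOLRule (hEps (hap (hNull) (hZero))) .top

/-- The (non polarized) rewrite system HOL, each rule being taken both as a
negative and as a positive rule. -/
def HOLsys : PRS LHOL where
  eqns := HOLEq
  neg := HOLRule
  pos := HOLRule
  neg_atomic := by rintro P A h; cases h <;> trivial
  pos_atomic := by rintro P A h; cases h <;> trivial

/-- The equations of HOL±. -/
inductive HOLpmEq : (s : STy) → Term LHOLpm s → Term LHOLpm s → Prop where
  | Keq (T U : STy) :
      HOLpmEq T (pap (pap (pK T U) (.var 0)) (.var 1)) (.var 0)
  | Seq (T U V : STy) :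
      HOLpmEq V (pap (pap (pap (pS T U V) (.var 0)) (.var 1)) (.var 2))
        (pap (pap (.var 0) (.var 2)) (pap (.var 1) (.var 2)))
  | PredSucc :
      HOLpmEq .iota (pap (pPred) (pap (pSucc) (.var 0))) (.var 0)

/-- The negative rules of HOL±. -/
inductive HOLpmNeg : Form LHOLpm → Form LHOLpm → Prop where
  | orRule :
      HOLpmNeg (pEps (pap (pap (pOr) (.var 0)) (.var 1)))
        (.or (pEps (.var 0)) (pEps (.var 1)))
  | notRule :
      HOLpmNeg (pEps (pap (pNot) (.var 0))) (.not (pEps (.var 0)))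
  | allRule (T : STy) :
      HOLpmNeg (pEps (pap (pAll T) (.var 0)))
        (.all T (pEps (pap (.var 0) (.var 0))))
  | nullSucc :
      HOLpmNeg (pEps (pap (pNull) (pap (pSucc) (.var 0)))) .bot

/-- The positive rules of HOL±. -/
inductive HOLpmPos : Form LHOLpm → Form LHOLpm → Prop where
  | orRule₁ :
      HOLpmPos (pEps (pap (pap (pOr) (.var 0)) (.var 1)))
        (.not (.not (pEps (.var 0))))
  | orRule₂ :
      HOLpmPos (pEps (pap (pap (pOr) (.var 0)) (.var 1)))
        (.not (.not (pEps (.var 1))))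
  | notRule :
      HOLpmPos (pEps (pap (pNot) (.var 0))) (.not (pEps (.var 0)))
  | allRule (T : STy) :
      HOLpmPos (pEps (pap (pAll T) (.var 0)))
        (.not (.not (pEps (pap (.var 0) (hH T (.var 0))))))
  | nullZero :
      HOLpmPos (pEps (pap (pNull) (pZero))) (.not .bot)

/-- The clausal polarized rewrite system HOL±. -/
def HOLpm : PRS LHOLpm where
  eqns := HOLpmEq
  neg := HOLpmNeg
  pos := HOLpmPos
  neg_atomic := by rintro P A h; cases h <;> trivial
  pos_atomic := by rintro P A h; cases h <;> trivial

/-- The embedding of the terms of HOL into those of HOL±. -/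
def embT : (s : STy) → Term LHOL s → Term LHOLpm s
  | _, .var n => .var n
  | _, .func f args => Term.func (L := LHOLpm) (Sum.inl f) fun i => embT _ (args i)

/-- The embedding of the propositions of HOL into those of HOL±; a proposition
of HOL± contains no occurrence of the symbols `H_T` if and only if it is in the
image of this embedding. -/
def embF : Form LHOL → Form LHOLpm
  | .pred _ args => Form.pred (L := LHOLpm) () fun i => embT _ (args i)
  | .bot => .bot
  | .top => .top
  | .not A => .not (embF A)
  | .and A B => .and (embF A) (embF B)
  | .or A B => .or (embF A) (embF B)
  | .imp A B => .imp (embF A) (embF B)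
  | .all s A => .all s (embF A)
  | .ex s A => .ex s (embF A)

/-! ### Renamings and substitutions -/

theorem liftSubst_var (s₀ : L.Sorts) (ρ : (s : L.Sorts) → ℕ → ℕ) :
    liftSubst s₀ (fun s n => Term.var (ρ s n)) = fun s n => .var (liftRen s₀ ρ s n) := by
  funext s n
  by_cases h : s = s₀
  · cases n <;> simp [liftSubst, liftRen, h, Term.rename, shiftRen]
  · simp [liftSubst, liftRen, h, Term.rename, shiftRen]

theorem Term.rename_eq_subst (ρ : (s : L.Sorts) → ℕ → ℕ) {s : L.Sorts} (t : Term L s) :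
    Term.rename ρ s t = Term.subst (fun s n => .var (ρ s n)) s t := by
  induction t with
  | var n => rfl
  | func f args ih => simp only [Term.rename, Term.subst, ih]

theorem Form.rename_eq_subst (ρ : (s : L.Sorts) → ℕ → ℕ) (A : Form L) :
    Form.rename ρ A = Form.subst (fun s n => .var (ρ s n)) A := by
  induction A generalizing ρ <;>
    simp_all [Form.rename, Form.subst, Term.rename_eq_subst, liftSubst_var]

theorem Term.subst_var {s : L.Sorts} (t : Term L s) : Term.subst (fun _ n => .var n) s t = t := by
  induction t with
  | var n => rfl
  | func f args ih => simp only [Term.subst, ih]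

theorem liftRen_id (s₀ : L.Sorts) : liftRen s₀ (fun _ n => n) = fun _ n => n := by
  funext s n
  by_cases h : s = s₀ <;> cases n <;> simp [liftRen, h]

theorem Form.subst_var (A : Form L) : Form.subst (fun _ n => .var n) A = A := by
  have h (s : L.Sorts) : liftSubst s (fun _ n => Term.var n) = fun _ n => .var n := by
    rw [liftSubst_var s (fun _ n => n), liftRen_id]
  induction A <;> simp_all [Form.subst, Term.subst_var]

theorem Term.subst_rename (σ : (s : L.Sorts) → ℕ → Term L s) (ρ : (s : L.Sorts) → ℕ → ℕ)
    {s : L.Sorts} (t : Term L s) :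
    Term.subst σ s (Term.rename ρ s t) = Term.subst (fun s n => σ s (ρ s n)) s t := by
  induction t with
  | var n => rfl
  | func f args ih => simp only [Term.rename, Term.subst, ih]

theorem Term.rename_subst (ρ : (s : L.Sorts) → ℕ → ℕ) (σ : (s : L.Sorts) → ℕ → Term L s)
    {s : L.Sorts} (t : Term L s) :
    Term.rename ρ s (Term.subst σ s t) =
      Term.subst (fun s n => Term.rename ρ s (σ s n)) s t := by
  induction t with
  | var n => rfl
  | func f args ih => simp only [Term.rename, Term.subst, ih]

theorem Term.subst_subst (τ σ : (s : L.Sorts) → ℕ → Term L s) {s : L.Sorts} (t : Term L s) :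
    Term.subst τ s (Term.subst σ s t) =
      Term.subst (fun s n => Term.subst τ s (σ s n)) s t := by
  induction t with
  | var n => rfl
  | func f args ih => simp only [Term.subst, ih]

theorem subst_liftSubst (s₀ : L.Sorts) (τ σ : (s : L.Sorts) → ℕ → Term L s) :
    (fun s n => Term.subst (liftSubst s₀ τ) s (liftSubst s₀ σ s n)) =
      liftSubst s₀ (fun s n => Term.subst τ s (σ s n)) := by
  have key {s} (t : Term L s) : Term.subst (liftSubst s₀ τ) s (Term.rename (shiftRen s₀) s t) =
      Term.rename (shiftRen s₀) s (Term.subst τ s t) := by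
    rw [Term.subst_rename, Term.rename_subst]
    congr 1
    funext s n
    by_cases h : s = s₀ <;> simp [liftSubst, shiftRen, h]
  funext s n
  by_cases h : s = s₀
  · subst h
    cases n
    · simp [liftSubst, Term.subst]
    · simpa [liftSubst] using key _
  · simpa [liftSubst, h] using key _

theorem Form.subst_subst (τ σ : (s : L.Sorts) → ℕ → Term L s) (A : Form L) :
    Form.subst τ (Form.subst σ A) = Form.subst (fun s n => Term.subst τ s (σ s n)) A := by
  induction A generalizing τ σ <;>
    simp_all [Form.subst, Term.subst_subst, subst_liftSubst]

theorem Form.subst_rename (σ : (s : L.Sorts) → ℕ → Term L s) (ρ : (s : L.Sorts) → ℕ → ℕ)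
    (A : Form L) :
    Form.subst σ (Form.rename ρ A) = Form.subst (fun s n => σ s (ρ s n)) A := by
  rw [Form.rename_eq_subst, Form.subst_subst]
  rfl

theorem Form.rename_subst (ρ : (s : L.Sorts) → ℕ → ℕ) (σ : (s : L.Sorts) → ℕ → Term L s)
    (A : Form L) :
    Form.rename ρ (Form.subst σ A) = Form.subst (fun s n => Term.rename ρ s (σ s n)) A := by
  rw [Form.rename_eq_subst, Form.subst_subst]
  simp only [Term.rename_eq_subst]

theorem Form.rename_rename (ρ' ρ : (s : L.Sorts) → ℕ → ℕ) (A : Form L) :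
    Form.rename ρ' (Form.rename ρ A) = Form.rename (fun s n => ρ' s (ρ s n)) A := by
  rw [Form.rename_eq_subst ρ', Form.subst_rename, Form.rename_eq_subst]

theorem Form.rename_shift (s₀ : L.Sorts) (ρ : (s : L.Sorts) → ℕ → ℕ) (A : Form L) :
    Form.rename (liftRen s₀ ρ) (Form.shift s₀ A) = Form.shift s₀ (Form.rename ρ A) := by
  rw [Form.shift, Form.shift, Form.rename_rename, Form.rename_rename]
  congr 1
  funext s n
  by_cases h : s = s₀ <;> simp [liftRen, shiftRen, h]

/-- Extend an assignment of terms by a new value for the variable `0` of sort `s`. -/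
def pushTerm (σ : (s : L.Sorts) → ℕ → Term L s) {s : L.Sorts} (t : Term L s) :
    (s' : L.Sorts) → ℕ → Term L s' :=
  fun s' n =>
    if h : s = s' then
      match n with
      | 0 => h ▸ t
      | n + 1 => σ s' n
    else σ s' n

theorem pushTerm_shiftRen (σ : (s : L.Sorts) → ℕ → Term L s) {s₀ : L.Sorts} (t : Term L s₀) :
    (fun s n => pushTerm σ t s (shiftRen s₀ s n)) = σ := by
  funext s n
  by_cases h : s₀ = s
  · subst h; simp [pushTerm, shiftRen]
  · simp [pushTerm, shiftRen, h, Ne.symm h]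

theorem subst0_eq_pushTerm {s : L.Sorts} (t : Term L s) :
    subst0 t = pushTerm (fun _ n => .var n) t := by
  funext s' n
  cases n <;> simp [subst0, pushTerm]

theorem inst_subst_liftSubst (σ : (s : L.Sorts) → ℕ → Term L s) {s₀ : L.Sorts} (t : Term L s₀)
    (A : Form L) :
    Form.inst t (Form.subst (liftSubst s₀ σ) A) = Form.subst (pushTerm σ t) A := by
  rw [Form.inst, Form.subst_subst, subst0_eq_pushTerm]
  congr 1
  funext s n
  have key (u : Term L s) :
      Term.subst (pushTerm (fun _ n => .var n) t) s (Term.rename (shiftRen s₀) s u) = u := by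
    rw [Term.subst_rename]
    conv_rhs => rw [← Term.subst_var u]
    congr 1
    exact pushTerm_shiftRen _ t
  by_cases h : s₀ = s
  · subst h
    cases n
    · simp [liftSubst, pushTerm, Term.subst]
    · simpa [liftSubst, pushTerm] using key _
  · simpa [liftSubst, pushTerm, h, Ne.symm h] using key _

theorem subst_inst (σ : (s : L.Sorts) → ℕ → Term L s) {s₀ : L.Sorts} (t : Term L s₀)
    (A : Form L) :
    Form.subst σ (Form.inst t A) = Form.subst (pushTerm σ (Term.subst σ s₀ t)) A := by
  rw [Form.inst, Form.subst_subst, subst0_eq_pushTerm]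
  congr 1
  funext s n
  by_cases h : s₀ = s
  · subst h
    cases n <;> simp [pushTerm, Term.subst]
  · simp [pushTerm, Term.subst, h]

theorem rename_inst (ρ : (s : L.Sorts) → ℕ → ℕ) {s₀ : L.Sorts} (t : Term L s₀) (A : Form L) :
    Form.rename ρ (Form.inst t A) =
      Form.inst (Term.rename ρ s₀ t) (Form.rename (liftRen s₀ ρ) A) := by
  rw [Form.rename_eq_subst, subst_inst, Form.rename_eq_subst (liftRen s₀ ρ), ← liftSubst_var,
    inst_subst_liftSubst, Term.rename_eq_subst]

theorem inst_var_rename_shift (s₀ : L.Sorts) (A : Form L) :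
    Form.inst (.var 0 : Term L s₀) (Form.rename (liftRen s₀ (shiftRen s₀)) A) = A := by
  rw [Form.rename_eq_subst, ← liftSubst_var, inst_subst_liftSubst]
  conv_rhs => rw [← Form.subst_var A]
  congr 1
  funext s n
  by_cases h : s₀ = s
  · subst h
    cases n <;> simp [pushTerm, shiftRen]
  · simp [pushTerm, shiftRen, h, Ne.symm h]

/-! ### Free variables -/

theorem Term.subst_congr {σ σ' : (s : L.Sorts) → ℕ → Term L s} {s : L.Sorts} {t : Term L s}
    (h : ∀ v ∈ Term.freeList s t, σ v.1 v.2 = σ' v.1 v.2) :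
    Term.subst σ s t = Term.subst σ' s t := by
  induction t with
  | var n => simpa [Term.subst, Term.freeList] using h
  | func f args ih =>
    simp only [Term.subst]
    congr 1
    funext i
    refine ih i fun v hv => h v ?_
    simp only [Term.freeList, List.mem_flatMap]
    exact ⟨i, List.mem_finRange i, hv⟩

theorem liftSubst_congr {σ σ' : (s : L.Sorts) → ℕ → Term L s} {s : L.Sorts}
    {l : List ((_ : L.Sorts) × ℕ)} (h : ∀ v ∈ unbind s l, σ v.1 v.2 = σ' v.1 v.2) :
    ∀ v ∈ l, liftSubst s σ v.1 v.2 = liftSubst s σ' v.1 v.2 := by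
  rintro ⟨s', n⟩ hv
  by_cases hs : s' = s
  · subst hs
    cases n with
    | zero => simp [liftSubst]
    | succ n =>
      have := h ⟨s', n⟩ (List.mem_map.2 ⟨⟨s', n + 1⟩, by simpa using hv, by simp⟩)
      simp only [liftSubst, if_true, this]
  · have := h ⟨s', n⟩ (List.mem_map.2 ⟨⟨s', n⟩, by simpa [hs] using hv, by simp [hs]⟩)
    simp only [liftSubst, hs, if_false, this]

theorem Form.subst_congr {σ σ' : (s : L.Sorts) → ℕ → Term L s} {A : Form L}
    (h : ∀ v ∈ A.freeList, σ v.1 v.2 = σ' v.1 v.2) :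
    Form.subst σ A = Form.subst σ' A := by
  induction A generalizing σ σ' with
  | pred p args =>
    simp only [Form.subst]
    congr 1
    funext i
    refine Term.subst_congr fun v hv => h v ?_
    simp only [Form.freeList, List.mem_flatMap]
    exact ⟨i, List.mem_finRange i, hv⟩
  | bot => rfl
  | top => rfl
  | not A ih => simp only [Form.subst, ih h]
  | and A B ihA ihB | or A B ihA ihB | imp A B ihA ihB =>
    simp only [Form.freeList, List.mem_append] at h
    simp only [Form.subst, ihA fun v hv => h v (.inl hv), ihB fun v hv => h v (.inr hv)]
  | all s A ih | ex s A ih =>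
    simp only [Form.subst, ih (liftSubst_congr h)]

theorem Form.rename_congr {ρ ρ' : (s : L.Sorts) → ℕ → ℕ} {A : Form L}
    (h : ∀ v ∈ A.freeList, ρ v.1 v.2 = ρ' v.1 v.2) :
    Form.rename ρ A = Form.rename ρ' A := by
  rw [Form.rename_eq_subst, Form.rename_eq_subst]
  refine Form.subst_congr fun v hv => ?_
  rw [h v hv]

theorem Form.subst_of_freeList_eq_nil {A : Form L} (h : A.freeList = [])
    (σ : (s : L.Sorts) → ℕ → Term L s) : Form.subst σ A = A := by
  rw [Form.subst_congr (σ' := fun _ n => .var n) (by simp [h]), Form.subst_var]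

theorem Form.shift_of_freeList_eq_nil {A : Form L} (h : A.freeList = []) (s : L.Sorts) :
    Form.shift s A = A := by
  rw [Form.shift, Form.rename_eq_subst, Form.subst_of_freeList_eq_nil h]

theorem Term.freeList_rename (ρ : (s : L.Sorts) → ℕ → ℕ) {s : L.Sorts} (t : Term L s) :
    Term.freeList s (Term.rename ρ s t) =
      (Term.freeList s t).map fun v => ⟨v.1, ρ v.1 v.2⟩ := by
  induction t with
  | var n => rfl
  | func f args ih => simp only [Term.rename, Term.freeList, List.map_flatMap, ih]

theorem unbind_cons_zero (s : L.Sorts) (l : List ((_ : L.Sorts) × ℕ)) :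
    unbind s (⟨s, 0⟩ :: l) = unbind s l := by
  simp [unbind]

theorem unbind_cons_succ (s : L.Sorts) (n : ℕ) (l : List ((_ : L.Sorts) × ℕ)) :
    unbind s (⟨s, n + 1⟩ :: l) = ⟨s, n⟩ :: unbind s l := by
  simp [unbind]

theorem unbind_cons_of_ne {s s' : L.Sorts} (h : s' ≠ s) (n : ℕ)
    (l : List ((_ : L.Sorts) × ℕ)) :
    unbind s (⟨s', n⟩ :: l) = ⟨s', n⟩ :: unbind s l := by
  simp [unbind, h]

theorem unbind_map_liftRen (s : L.Sorts) (ρ : (s : L.Sorts) → ℕ → ℕ)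
    (l : List ((_ : L.Sorts) × ℕ)) :
    unbind s (l.map fun v => ⟨v.1, liftRen s ρ v.1 v.2⟩) =
      (unbind s l).map fun v => ⟨v.1, ρ v.1 v.2⟩ := by
  induction l with
  | nil => rfl
  | cons v l ih =>
    obtain ⟨s', n⟩ := v
    rw [List.map_cons]
    by_cases hs : s' = s
    · subst hs
      cases n with
      | zero => simpa [liftRen, unbind_cons_zero] using ih
      | succ n => simpa [liftRen, unbind_cons_succ] using ih
    · rw [unbind_cons_of_ne hs, unbind_cons_of_ne hs, List.map_cons, ih]
      simp [liftRen, hs]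

theorem Form.freeList_rename (ρ : (s : L.Sorts) → ℕ → ℕ) (A : Form L) :
    (Form.rename ρ A).freeList = A.freeList.map fun v => ⟨v.1, ρ v.1 v.2⟩ := by
  induction A generalizing ρ <;>
    simp_all [Form.rename, Form.freeList, Term.freeList_rename, List.map_flatMap,
      unbind_map_liftRen]

/-- The renaming sending the variable `k` of sort `s` to `0` and shifting the others. -/
def abstractRen (s : L.Sorts) (k : ℕ) : (s : L.Sorts) → ℕ → ℕ :=
  fun s' n => if s' = s then (if n = k then 0 else n + 1) else n

theorem Form.abstractVar_eq_rename (s : L.Sorts) (k : ℕ) (A : Form L) :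
    A.abstractVar s k = .all s (Form.rename (abstractRen s k) A) := by
  rw [Form.abstractVar, Form.rename_eq_subst]
  congr 2
  funext s' n
  unfold abstractRen
  split_ifs <;> rfl

theorem Form.freeList_abstractVar (s : L.Sorts) (k : ℕ) (A : Form L) :
    (A.abstractVar s k).freeList = A.freeList.filter fun v => decide ¬(v = ⟨s, k⟩) := by
  rw [Form.abstractVar_eq_rename, Form.freeList, Form.freeList_rename]
  induction A.freeList with
  | nil => rfl
  | cons v l ih =>
    obtain ⟨s', n⟩ := v
    rw [List.map_cons]
    by_cases hs : s' = s
    · subst hs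
      by_cases hn : n = k
      · simpa [abstractRen, hn, unbind_cons_zero] using ih
      · simpa [abstractRen, hn, unbind_cons_succ] using ih
    · rw [unbind_cons_of_ne hs, ih]
      simp [abstractRen, hs]

theorem freeList_closeSteps (n : ℕ) (A : Form L) (h : A.freeList.length ≤ n) :
    (closeSteps n A).freeList = [] := by
  induction n generalizing A with
  | zero => simpa [closeSteps] using h
  | succ n ih =>
    rw [closeSteps]
    split
    · assumption
    · rename_i v l hv
      refine ih _ ?_
      rw [Form.freeList_abstractVar, hv]
      have := List.length_filter_le (fun w => decide ¬(w = v)) l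
      simp [hv] at h this ⊢
      omega

theorem Form.shift_univClosure (s : L.Sorts) (A : Form L) :
    Form.shift s (univClosure A) = univClosure A :=
  Form.shift_of_freeList_eq_nil (freeList_closeSteps _ _ le_rfl) s

/-! ### Rewriting and renaming -/

theorem EqE.rename {rs : PRS L} (ρ : (s : L.Sorts) → ℕ → ℕ) {s : L.Sorts} {t u : Term L s}
    (h : EqE rs s t u) : EqE rs s (Term.rename ρ s t) (Term.rename ρ s u) := by
  induction h with
  | base σ h => rw [Term.rename_subst, Term.rename_subst]; exact .base _ h
  | refl t => exact .refl _
  | symm _ ih => exact ih.symm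
  | trans _ _ ih₁ ih₂ => exact ih₁.trans ih₂
  | congr f _ ih => exact .congr f ih

mutual
  theorem RwNeg.rename {rs : PRS L} {A B : Form L} (h : RwNeg rs A B)
      (ρ : (s : L.Sorts) → ℕ → ℕ) : RwNeg rs (Form.rename ρ A) (Form.rename ρ B) := by
    cases h with
    | predArg p args args' i h h' =>
      exact .predArg p _ _ i (h.rename ρ) fun j hj => by rw [h' j hj]
    | rule σ h => rw [Form.rename_subst, Form.rename_subst]; exact .rule _ h
    | notC h => exact .notC (h.rename _)
    | andL h => exact .andL (h.rename _)
    | andR h => exact .andR (h.rename _)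
    | orL h => exact .orL (h.rename _)
    | orR h => exact .orR (h.rename _)
    | impL h => exact .impL (h.rename _)
    | impR h => exact .impR (h.rename _)
    | allC h => exact .allC (h.rename _)
    | exC h => exact .exC (h.rename _)
  theorem RwPos.rename {rs : PRS L} {A B : Form L} (h : RwPos rs A B)
      (ρ : (s : L.Sorts) → ℕ → ℕ) : RwPos rs (Form.rename ρ A) (Form.rename ρ B) := by
    cases h with
    | predArg p args args' i h h' =>
      exact .predArg p _ _ i (h.rename ρ) fun j hj => by rw [h' j hj]
    | rule σ h => rw [Form.rename_subst, Form.rename_subst]; exact .rule _ h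
    | notC h => exact .notC (h.rename _)
    | andL h => exact .andL (h.rename _)
    | andR h => exact .andR (h.rename _)
    | orL h => exact .orL (h.rename _)
    | orR h => exact .orR (h.rename _)
    | impL h => exact .impL (h.rename _)
    | impR h => exact .impR (h.rename _)
    | allC h => exact .allC (h.rename _)
    | exC h => exact .exC (h.rename _)
end

theorem RwNegS.rename {rs : PRS L} {A B : Form L} (h : RwNegS rs A B)
    (ρ : (s : L.Sorts) → ℕ → ℕ) : RwNegS rs (Form.rename ρ A) (Form.rename ρ B) :=
  Relation.ReflTransGen.lift _ (fun _ _ h => h.rename ρ) _ _ h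

theorem RwPosS.rename {rs : PRS L} {A B : Form L} (h : RwPosS rs A B)
    (ρ : (s : L.Sorts) → ℕ → ℕ) : RwPosS rs (Form.rename ρ A) (Form.rename ρ B) :=
  Relation.ReflTransGen.lift _ (fun _ _ h => h.rename ρ) _ _ h

theorem Form.IsAtomic.rename {A : Form L} (h : A.IsAtomic) (ρ : (s : L.Sorts) → ℕ → ℕ) :
    (Form.rename ρ A).IsAtomic := by
  cases A <;> simp_all [Form.IsAtomic, Form.rename]

theorem map_rename_map_shift (s : L.Sorts) (ρ : (s : L.Sorts) → ℕ → ℕ)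
    (Γ : Multiset (Form L)) :
    (Γ.map (Form.shift s)).map (Form.rename (liftRen s ρ)) =
      (Γ.map (Form.rename ρ)).map (Form.shift s) := by
  simp only [Multiset.map_map, Function.comp_def, Form.rename_shift]

theorem Pf.rename {rs : PRS L} {c : Bool} {n : ℕ} {Γ Δ : Multiset (Form L)}
    (h : Pf rs c n Γ Δ) (ρ : (s : L.Sorts) → ℕ → ℕ) :
    Pf rs c n (Γ.map (Form.rename ρ)) (Δ.map (Form.rename ρ)) := by
  induction h generalizing ρ with
  | ax hP h₁ h₂ => exact .ax (hP.rename ρ) (h₁.rename ρ) (h₂.rename ρ)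
  | cut hc h₁ h₂ _ _ ih₁ ih₂ =>
    simp only [Multiset.map_cons] at ih₁ ih₂ ⊢
    exact .cut hc (h₁.rename ρ) (h₂.rename ρ) (ih₁ ρ) (ih₂ ρ)
  | contrL h₁ h₂ _ ih =>
    simp only [Multiset.map_cons] at ih ⊢
    exact .contrL (h₁.rename ρ) (h₂.rename ρ) (ih ρ)
  | contrR h₁ h₂ _ ih =>
    simp only [Multiset.map_cons] at ih ⊢
    exact .contrR (h₁.rename ρ) (h₂.rename ρ) (ih ρ)
  | weakL _ ih => rw [Multiset.map_cons]; exact .weakL (ih ρ)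
  | weakR _ ih => rw [Multiset.map_cons]; exact .weakR (ih ρ)
  | topR h => rw [Multiset.map_cons]; exact .topR (h.rename ρ)
  | botL h => rw [Multiset.map_cons]; exact .botL (h.rename ρ)
  | notL h _ ih =>
    simp only [Multiset.map_cons] at ih ⊢
    exact .notL (h.rename ρ) (ih ρ)
  | notR h _ ih =>
    simp only [Multiset.map_cons] at ih ⊢
    exact .notR (h.rename ρ) (ih ρ)
  | andL h _ ih =>
    simp only [Multiset.map_cons] at ih ⊢
    exact .andL (h.rename ρ) (ih ρ)
  | andR h _ _ ih₁ ih₂ =>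
    simp only [Multiset.map_cons] at ih₁ ih₂ ⊢
    exact .andR (h.rename ρ) (ih₁ ρ) (ih₂ ρ)
  | orL h _ _ ih₁ ih₂ =>
    simp only [Multiset.map_cons] at ih₁ ih₂ ⊢
    exact .orL (h.rename ρ) (ih₁ ρ) (ih₂ ρ)
  | orR h _ ih =>
    simp only [Multiset.map_cons] at ih ⊢
    exact .orR (h.rename ρ) (ih ρ)
  | impL h _ _ ih₁ ih₂ =>
    simp only [Multiset.map_cons] at ih₁ ih₂ ⊢
    exact .impL (h.rename ρ) (ih₁ ρ) (ih₂ ρ)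
  | impR h _ ih =>
    simp only [Multiset.map_cons] at ih ⊢
    exact .impR (h.rename ρ) (ih ρ)
  | allL h₁ h₂ _ ih =>
    simp only [Multiset.map_cons] at ih ⊢
    exact .allL (h₁.rename ρ) (rename_inst ρ _ _ ▸ h₂.rename ρ) (ih ρ)
  | @allR _ _ s _ _ _ h _ ih =>
    simp only [Multiset.map_cons] at ih ⊢
    have := ih (liftRen s ρ)
    simp only [map_rename_map_shift] at this
    exact .allR (h.rename ρ) this
  | @exL _ _ s _ _ _ h _ ih =>
    simp only [Multiset.map_cons] at ih ⊢
    have := ih (liftRen s ρ)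
    simp only [map_rename_map_shift] at this
    exact .exL (h.rename ρ) this
  | exR h₁ h₂ _ ih =>
    simp only [Multiset.map_cons] at ih ⊢
    exact .exR (h₁.rename ρ) (rename_inst ρ _ _ ▸ h₂.rename ρ) (ih ρ)

/-! ### Derived rules of the sequent calculus -/

theorem Provable.weaken {rs : PRS L} {Γ Δ : Multiset (Form L)} (h : Provable rs Γ Δ)
    (Γ' Δ' : Multiset (Form L)) : Provable rs (Γ' + Γ) (Δ' + Δ) := by
  induction Γ' using Multiset.induction_on with
  | empty =>
    induction Δ' using Multiset.induction_on with
    | empty => simpa using h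
    | cons A Δ' ih =>
      obtain ⟨n, hn⟩ := ih
      exact ⟨n + 1, by rw [Multiset.cons_add]; exact .weakR hn⟩
  | cons A Γ' ih =>
    obtain ⟨n, hn⟩ := ih
    exact ⟨n + 1, by rw [Multiset.cons_add]; exact .weakL hn⟩

theorem Provable.contractLeft {rs : PRS L} {Γ Γ' Δ : Multiset (Form L)} (hΓ : Γ ⊆ Γ')
    (h : Provable rs (Γ + Γ') Δ) : Provable rs Γ' Δ := by
  induction Γ using Multiset.induction_on with
  | empty => simpa using h
  | cons A Γ ih =>
    obtain ⟨hA, hΓ⟩ := Multiset.cons_subset.1 hΓ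
    refine ih hΓ ?_
    obtain ⟨Γ', rfl⟩ := Multiset.exists_cons_of_mem hA
    rw [Multiset.cons_add, Multiset.add_cons] at h
    obtain ⟨n, hn⟩ := h
    exact ⟨n + 1, by rw [Multiset.add_cons]; exact .contrL .refl .refl hn⟩

theorem Provable.contractRight {rs : PRS L} {Γ Δ Δ' : Multiset (Form L)} (hΔ : Δ ⊆ Δ')
    (h : Provable rs Γ (Δ + Δ')) : Provable rs Γ Δ' := by
  induction Δ using Multiset.induction_on with
  | empty => simpa using h
  | cons A Δ ih =>
    obtain ⟨hA, hΔ⟩ := Multiset.cons_subset.1 hΔ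
    refine ih hΔ ?_
    obtain ⟨Δ', rfl⟩ := Multiset.exists_cons_of_mem hA
    rw [Multiset.cons_add, Multiset.add_cons] at h
    obtain ⟨n, hn⟩ := h
    exact ⟨n + 1, by rw [Multiset.add_cons]; exact .contrR .refl .refl hn⟩

theorem Provable.mono {rs : PRS L} {Γ Γ' Δ Δ' : Multiset (Form L)} (h : Provable rs Γ Δ)
    (hΓ : Γ ⊆ Γ') (hΔ : Δ ⊆ Δ') : Provable rs Γ' Δ' := by
  have := h.weaken Γ' Δ'
  rw [add_comm Γ', add_comm Δ'] at this
  exact (this.contractLeft hΓ).contractRight hΔ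

namespace ProvableIn

variable {rs : PRS L} {T : Set (Form L)} {Γ Γ' Δ Δ' : Multiset (Form L)} {A B C : Form L}

theorem mono (h : ProvableIn rs T Γ Δ) (hΓ : Γ ⊆ Γ') (hΔ : Δ ⊆ Δ') : ProvableIn rs T Γ' Δ' := by
  obtain ⟨T', hT', h⟩ := h
  refine ⟨T', hT', h.mono (fun A hA => ?_) hΔ⟩
  rw [Multiset.mem_add] at hA ⊢
  exact hA.imp_left fun h => hΓ h

theorem combine {Γ₁ Γ₂ Δ₁ Δ₂ : Multiset (Form L)}
    (h₁ : ProvableIn rs T Γ₁ Δ₁) (h₂ : ProvableIn rs T Γ₂ Δ₂) :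
    ∃ T' : Multiset (Form L), (∀ A ∈ T', A ∈ T) ∧
      Provable rs (Γ₁ + T') Δ₁ ∧ Provable rs (Γ₂ + T') Δ₂ := by
  obtain ⟨T₁, hT₁, h₁⟩ := h₁
  obtain ⟨T₂, hT₂, h₂⟩ := h₂
  refine ⟨T₁ + T₂, fun A hA => ?_, h₁.mono ?_ (fun _ => id), h₂.mono ?_ (fun _ => id)⟩
  · rcases Multiset.mem_add.1 hA with h | h
    exacts [hT₁ A h, hT₂ A h]
  all_goals intro A hA; simp only [Multiset.mem_add] at hA ⊢; tauto

theorem cut (h₁ : ProvableIn rs T (A ::ₘ Γ) Δ) (h₂ : ProvableIn rs T Γ (A ::ₘ Δ)) :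
    ProvableIn rs T Γ Δ := by
  obtain ⟨T', hT', ⟨n, hn⟩, ⟨m, hm⟩⟩ := combine h₁ h₂
  rw [Multiset.cons_add] at hn
  exact ⟨T', hT', _, .cut rfl .refl .refl hn hm⟩

theorem atom (hA : A.IsAtomic) : ProvableIn rs T (A ::ₘ Γ) (A ::ₘ Δ) := by
  have : Provable rs {A} {A} := ⟨1, .ax hA .refl .refl⟩
  exact ⟨0, by simp, this.mono (by simp) (by simp)⟩

theorem topR : ProvableIn rs T Γ (.top ::ₘ Δ) :=
  ⟨0, by simp, 1, .topR .refl⟩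

theorem botL : ProvableIn rs T (.bot ::ₘ Γ) Δ :=
  ⟨0, by simp, 1, by rw [Multiset.cons_add]; exact .botL .refl⟩

theorem notL (h : ProvableIn rs T Γ (A ::ₘ Δ)) : ProvableIn rs T (.not A ::ₘ Γ) Δ := by
  obtain ⟨T', hT', n, hn⟩ := h
  exact ⟨T', hT', _, by rw [Multiset.cons_add]; exact .notL .refl hn⟩

theorem notR (h : ProvableIn rs T (A ::ₘ Γ) Δ) : ProvableIn rs T Γ (.not A ::ₘ Δ) := by
  obtain ⟨T', hT', n, hn⟩ := h
  rw [Multiset.cons_add] at hn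
  exact ⟨T', hT', _, .notR .refl hn⟩

theorem andL (h : ProvableIn rs T (A ::ₘ B ::ₘ Γ) Δ) : ProvableIn rs T (.and A B ::ₘ Γ) Δ := by
  obtain ⟨T', hT', n, hn⟩ := h
  rw [Multiset.cons_add, Multiset.cons_add] at hn
  exact ⟨T', hT', _, by rw [Multiset.cons_add]; exact .andL .refl hn⟩

theorem andR (h₁ : ProvableIn rs T Γ (A ::ₘ Δ)) (h₂ : ProvableIn rs T Γ (B ::ₘ Δ)) :
    ProvableIn rs T Γ (.and A B ::ₘ Δ) := by
  obtain ⟨T', hT', ⟨n, hn⟩, ⟨m, hm⟩⟩ := combine h₁ h₂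
  exact ⟨T', hT', _, .andR .refl hn hm⟩

theorem orL (h₁ : ProvableIn rs T (A ::ₘ Γ) Δ) (h₂ : ProvableIn rs T (B ::ₘ Γ) Δ) :
    ProvableIn rs T (.or A B ::ₘ Γ) Δ := by
  obtain ⟨T', hT', ⟨n, hn⟩, ⟨m, hm⟩⟩ := combine h₁ h₂
  rw [Multiset.cons_add] at hn hm
  exact ⟨T', hT', _, by rw [Multiset.cons_add]; exact .orL .refl hn hm⟩

theorem orR (h : ProvableIn rs T Γ (A ::ₘ B ::ₘ Δ)) : ProvableIn rs T Γ (.or A B ::ₘ Δ) := by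
  obtain ⟨T', hT', n, hn⟩ := h
  exact ⟨T', hT', _, .orR .refl hn⟩

theorem impL (h₁ : ProvableIn rs T Γ (A ::ₘ Δ)) (h₂ : ProvableIn rs T (B ::ₘ Γ) Δ) :
    ProvableIn rs T (.imp A B ::ₘ Γ) Δ := by
  obtain ⟨T', hT', ⟨n, hn⟩, ⟨m, hm⟩⟩ := combine h₁ h₂
  rw [Multiset.cons_add] at hm
  exact ⟨T', hT', _, by rw [Multiset.cons_add]; exact .impL .refl hn hm⟩

theorem impR (h : ProvableIn rs T (A ::ₘ Γ) (B ::ₘ Δ)) : ProvableIn rs T Γ (.imp A B ::ₘ Δ) := by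
  obtain ⟨T', hT', n, hn⟩ := h
  rw [Multiset.cons_add] at hn
  exact ⟨T', hT', _, .impR .refl hn⟩

theorem allL {s : L.Sorts} (t : Term L s)
    (h : ProvableIn rs T (Form.inst t A ::ₘ Γ) Δ) : ProvableIn rs T (.all s A ::ₘ Γ) Δ := by
  obtain ⟨T', hT', n, hn⟩ := h
  rw [Multiset.cons_add] at hn
  exact ⟨T', hT', _, by rw [Multiset.cons_add]; exact .allL .refl .refl hn⟩

theorem exR {s : L.Sorts} (t : Term L s)
    (h : ProvableIn rs T Γ (Form.inst t A ::ₘ Δ)) : ProvableIn rs T Γ (.ex s A ::ₘ Δ) := by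
  obtain ⟨T', hT', n, hn⟩ := h
  exact ⟨T', hT', _, .exR .refl .refl hn⟩

end ProvableIn

/-- The propositions of `T` are invariant under the shifting of free variables, as closed
propositions are. -/
def ShiftInvariant (T : Set (Form L)) : Prop := ∀ A ∈ T, ∀ s, Form.shift s A = A

theorem shiftInvariant_empty : ShiftInvariant (∅ : Set (Form L)) := fun _ h => h.elim

theorem ShiftInvariant.map_shift {T : Set (Form L)} (hT : ShiftInvariant T)
    {T' : Multiset (Form L)} (hT' : ∀ A ∈ T', A ∈ T) (s : L.Sorts) :
    T'.map (Form.shift s) = T' := by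
  conv_rhs => rw [← Multiset.map_id T']
  exact Multiset.map_congr rfl fun A hA => hT A (hT' A hA) s

namespace ProvableIn

variable {rs : PRS L} {T : Set (Form L)} {Γ Γ' Δ Δ' : Multiset (Form L)} {A A' B B' C : Form L}

theorem allR (hT : ShiftInvariant T) {s : L.Sorts}
    (h : ProvableIn rs T (Γ.map (Form.shift s)) (A ::ₘ Δ.map (Form.shift s))) :
    ProvableIn rs T Γ (.all s A ::ₘ Δ) := by
  obtain ⟨T', hT', n, hn⟩ := h
  refine ⟨T', hT', n + 1, .allR .refl ?_⟩
  rwa [Multiset.map_add, hT.map_shift hT']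

theorem exL (hT : ShiftInvariant T) {s : L.Sorts}
    (h : ProvableIn rs T (A ::ₘ Γ.map (Form.shift s)) (Δ.map (Form.shift s))) :
    ProvableIn rs T (.ex s A ::ₘ Γ) Δ := by
  obtain ⟨T', hT', n, hn⟩ := h
  refine ⟨T', hT', n + 1, ?_⟩
  rw [Multiset.cons_add] at hn ⊢
  refine .exL .refl ?_
  rwa [Multiset.map_add, hT.map_shift hT']

theorem swapL (h : ProvableIn rs T (A ::ₘ B ::ₘ Γ) Δ) : ProvableIn rs T (B ::ₘ A ::ₘ Γ) Δ :=
  Multiset.cons_swap A B Γ ▸ h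

theorem swapR (h : ProvableIn rs T Γ (A ::ₘ B ::ₘ Δ)) : ProvableIn rs T Γ (B ::ₘ A ::ₘ Δ) :=
  Multiset.cons_swap A B Δ ▸ h

theorem weakL (h : ProvableIn rs T Γ Δ) : ProvableIn rs T (A ::ₘ Γ) Δ :=
  h.mono (Multiset.subset_cons _ _) (fun _ => id)

theorem weakR (h : ProvableIn rs T Γ Δ) : ProvableIn rs T Γ (A ::ₘ Δ) :=
  h.mono (fun _ => id) (Multiset.subset_cons _ _)

theorem left_of_entails (h : ProvableIn rs T {A} {B}) (hB : ProvableIn rs T (B ::ₘ Γ) Δ) :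
    ProvableIn rs T (A ::ₘ Γ) Δ :=
  cut (hB.weakL.swapL) (h.mono (by simp) (by simp))

theorem right_of_entails (h : ProvableIn rs T {A} {B}) (hA : ProvableIn rs T Γ (A ::ₘ Δ)) :
    ProvableIn rs T Γ (B ::ₘ Δ) :=
  cut (h.mono (by simp) (by simp)) (hA.weakR.swapR)

theorem entails_trans (h₁ : ProvableIn rs T {A} {B}) (h₂ : ProvableIn rs T {B} {C}) :
    ProvableIn rs T {A} {C} :=
  left_of_entails h₁ h₂

theorem not_mono (h : ProvableIn rs T {A'} {A}) : ProvableIn rs T {.not A} {.not A'} :=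
  notL (notR h).swapR

theorem and_mono (h₁ : ProvableIn rs T {A} {A'}) (h₂ : ProvableIn rs T {B} {B'}) :
    ProvableIn rs T {.and A B} {.and A' B'} :=
  andL (andR (h₁.mono (by simp) (by simp)) (h₂.mono (by simp) (by simp)))

theorem or_mono (h₁ : ProvableIn rs T {A} {A'}) (h₂ : ProvableIn rs T {B} {B'}) :
    ProvableIn rs T {.or A B} {.or A' B'} :=
  orR (orL (h₁.mono (by simp) (by simp)) (h₂.mono (by simp) (by simp)))

theorem imp_mono (h₁ : ProvableIn rs T {A'} {A}) (h₂ : ProvableIn rs T {B} {B'}) :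
    ProvableIn rs T {.imp A B} {.imp A' B'} :=
  impR (swapL (impL (h₁.mono (by simp) (by simp)) (h₂.mono (by simp) (by simp))))

theorem all_mono (hT : ShiftInvariant T) {s : L.Sorts} (h : ProvableIn rs T {A} {A'}) :
    ProvableIn rs T {.all s A} {.all s A'} := by
  refine allR hT ?_
  rw [Multiset.map_singleton, Multiset.map_zero]
  refine allL (A := Form.rename (liftRen s (shiftRen s)) A) (.var 0) ?_
  rw [inst_var_rename_shift]
  exact h

theorem ex_mono (hT : ShiftInvariant T) {s : L.Sorts} (h : ProvableIn rs T {A} {A'}) :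
    ProvableIn rs T {.ex s A} {.ex s A'} := by
  refine exL hT ?_
  rw [Multiset.map_singleton, Multiset.map_zero]
  refine exR (A := Form.rename (liftRen s (shiftRen s)) A') (.var 0) ?_
  rw [inst_var_rename_shift]
  exact h

theorem entails_refl (hT : ShiftInvariant T) (A : Form L) : ProvableIn rs T {A} {A} := by
  induction A with
  | pred p args => exact atom trivial
  | bot => exact botL
  | top => exact topR
  | not A ih => exact not_mono ih
  | and A B ihA ihB => exact and_mono ihA ihB
  | or A B ihA ihB => exact or_mono ihA ihB
  | imp A B ihA ihB => exact imp_mono ihA ihB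
  | all s A ih => exact all_mono hT ih
  | ex s A ih => exact ex_mono hT ih

theorem ident (hT : ShiftInvariant T) : ProvableIn rs T (A ::ₘ Γ) (A ::ₘ Δ) :=
  (entails_refl hT A).mono (by simp) (by simp)

theorem entails_inst (hT : ShiftInvariant T) {s : L.Sorts} (t : Term L s) :
    ProvableIn rs T {.all s A} {Form.inst t A} :=
  allL t (entails_refl hT _)

theorem inst_entails (hT : ShiftInvariant T) {s : L.Sorts} (t : Term L s) :
    ProvableIn rs T {Form.inst t A} {.ex s A} :=
  exR t (entails_refl hT _)

theorem of_provable (h : Provable rs Γ Δ) : ProvableIn rs T Γ Δ :=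
  ⟨0, by simp, by simpa using h⟩

theorem provable (h : ProvableIn rs ∅ Γ Δ) : Provable rs Γ Δ := by
  obtain ⟨T', hT', h⟩ := h
  rwa [Multiset.eq_zero_of_forall_notMem (s := T') fun A hA => hT' A hA, add_zero] at h

/-- In the right rule of `∀`, the eigenvariable may be replaced by all terms. -/
theorem allR_of_forall_inst {s : L.Sorts}
    (h : ∀ t : Term L s, ProvableIn rs ∅ Γ (Form.inst t A ::ₘ Δ)) :
    ProvableIn rs ∅ Γ (.all s A ::ₘ Δ) := by
  obtain ⟨N, hN⟩ : ∃ N, ∀ B ∈ .all s A ::ₘ (Γ + Δ), ∀ v ∈ B.freeList, v.2 ≠ N := by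
    refine ⟨((Form.all s A ::ₘ (Γ + Δ)).bind fun B => ↑(B.freeList.map Sigma.snd)).sum + 1,
      fun B hB v hv => (Nat.lt_succ_of_le ?_).ne⟩
    refine Multiset.le_sum_of_mem (Multiset.mem_bind.2 ⟨B, hB, ?_⟩)
    exact Multiset.mem_coe.2 (List.mem_map_of_mem hv)
  let ρ : (s : L.Sorts) → ℕ → ℕ := fun s' n => if s' = s ∧ n = N then 0 else shiftRen s s' n
  have hρ (B) (hB : B ∈ Form.all s A ::ₘ (Γ + Δ)) : Form.rename ρ B = Form.shift s B :=
    Form.rename_congr fun v hv => if_neg fun h => hN B hB v hv h.2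
  have hA : Form.rename (liftRen s ρ) A = Form.rename (liftRen s (shiftRen s)) A := by
    simpa [Form.rename, Form.shift] using hρ _ (Multiset.mem_cons_self _ _)
  obtain ⟨n, hn⟩ := (h (.var N)).provable
  have := hn.rename ρ
  have hinst : Form.rename ρ (Form.inst (.var N : Term L s) A) = A := by
    rw [rename_inst, hA]
    simpa [Term.rename, ρ] using inst_var_rename_shift s A
  rw [Multiset.map_cons, hinst,
    Multiset.map_congr rfl fun B hB => hρ B (by simp [hB]),
    Multiset.map_congr (s := Δ) rfl fun B hB => hρ B (by simp [hB])] at this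
  exact allR shiftInvariant_empty (of_provable ⟨n, this⟩)

/-- In the left rule of `∃`, the eigenvariable may be replaced by all terms. -/
theorem exL_of_forall_inst {s : L.Sorts}
    (h : ∀ t : Term L s, ProvableIn rs ∅ (Form.inst t A ::ₘ Γ) Δ) :
    ProvableIn rs ∅ (.ex s A ::ₘ Γ) Δ := by
  have hn : ProvableIn rs ∅ Γ (.all s (.not A) ::ₘ Δ) :=
    allR_of_forall_inst fun t => (h t).notR
  have hi : ProvableIn rs ∅ (.ex s A ::ₘ {.all s (.not A)}) 0 := by
    refine exL shiftInvariant_empty ?_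
    rw [Multiset.map_singleton, Multiset.map_zero]
    refine swapL (allL (A := Form.rename (liftRen s (shiftRen s)) (.not A)) (.var 0) ?_)
    rw [inst_var_rename_shift]
    exact notL (ident shiftInvariant_empty)
  exact cut (hi.swapL.mono (Multiset.cons_subset_cons (by simp)) (by simp)) hn.weakL

end ProvableIn

/-! ### From rewriting to entailment -/

theorem RwNegS.entails {rs : PRS L} {A B : Form L} (h : RwNegS rs A B) :
    ProvableIn rs ∅ {A} {B} := by
  obtain ⟨n, hn⟩ := (ProvableIn.ident (rs := rs) (Γ := {B}) (Δ := 0) (A := B)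
    shiftInvariant_empty).provable
  exact .of_provable ⟨_, .contrL h h hn⟩

theorem RwPosS.entails {rs : PRS L} {A B : Form L} (h : RwPosS rs A B) :
    ProvableIn rs ∅ {B} {A} := by
  obtain ⟨n, hn⟩ := (ProvableIn.ident (rs := rs) (Γ := 0) (Δ := {B}) (A := B)
    shiftInvariant_empty).provable
  exact .of_provable ⟨_, .contrR h h hn⟩

theorem rwNegS_pred {rs : PRS L} (p : L.Pred)
    {args args' : (i : Fin (L.parity p).length) → Term L ((L.parity p).get i)}
    (h : ∀ i, EqE rs _ (args i) (args' i)) : RwNegS rs (.pred p args) (.pred p args') := by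
  have key (S : Finset (Fin (L.parity p).length)) :
      RwNegS rs (.pred p args) (.pred p fun i => if i ∈ S then args' i else args i) := by
    induction S using Finset.induction_on with
    | empty => simp only [Finset.notMem_empty, if_false]; exact .refl
    | insert a S ha ih =>
      refine ih.tail (.predArg p _ _ a ?_ fun j hj => ?_)
      · simpa only [ha, Finset.mem_insert_self, if_true, if_false] using h a
      · simp only [Finset.mem_insert, hj, false_or]
  simpa only [Finset.mem_univ, if_true] using key Finset.univ

/-! ### Substitution in models -/

theorem Model.evalT_subst (M : Model L) (φ : M.Val) (τ : (s : L.Sorts) → ℕ → Term L s)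
    {s : L.Sorts} (t : Term L s) :
    M.evalT φ s (Term.subst τ s t) = M.evalT (fun s n => M.evalT φ s (τ s n)) s t := by
  induction t with
  | var n => rfl
  | func f args ih => exact congrArg (M.interpF f) (funext ih)

theorem Model.evalT_rename (M : Model L) (φ : M.Val) (ρ : (s : L.Sorts) → ℕ → ℕ)
    {s : L.Sorts} (t : Term L s) :
    M.evalT φ s (Term.rename ρ s t) = M.evalT (fun s n => φ s (ρ s n)) s t := by
  rw [Term.rename_eq_subst, Model.evalT_subst]
  rfl

theorem Model.push_shiftRen (M : Model L) (φ : M.Val) {s₀ : L.Sorts} (d : M.dom s₀) :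
    (fun s n => M.push φ d s (shiftRen s₀ s n)) = φ := by
  funext s n
  by_cases h : s₀ = s
  · subst h
    simp [shiftRen, Model.push]
  · simp [shiftRen, Model.push, h, Ne.symm h]

theorem Model.evalT_liftSubst (M : Model L) (φ : M.Val) (τ : (s : L.Sorts) → ℕ → Term L s)
    {s₀ : L.Sorts} (d : M.dom s₀) :
    (fun s n => M.evalT (M.push φ d) s (liftSubst s₀ τ s n)) =
      M.push (fun s n => M.evalT φ s (τ s n)) d := by
  have key {s : L.Sorts} (u : Term L s) :
      M.evalT (M.push φ d) s (Term.rename (shiftRen s₀) s u) = M.evalT φ s u := by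
    rw [Model.evalT_rename, Model.push_shiftRen]
  funext s n
  by_cases h : s₀ = s
  · subst h
    cases n
    · simp [liftSubst, Model.push, Model.evalT]
    · simpa [liftSubst, Model.push] using key _
  · simpa [liftSubst, Model.push, h, Ne.symm h] using key _

theorem Model.evalT_subst0 (M : Model L) (φ : M.Val) {s₀ : L.Sorts} (t : Term L s₀) :
    (fun s n => M.evalT φ s (subst0 t s n)) = M.push φ (M.evalT φ s₀ t) := by
  funext s n
  by_cases h : s₀ = s
  · subst h
    cases n <;> simp [subst0, Model.push, Model.evalT]
  · simp [subst0, Model.push, Model.evalT, h]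

/-! ### A forcing semantics for the language with equality

The worlds are the sequents of `L`, ordered by inclusion, and an equality is forced when its
members are congruent modulo the equations. -/

/-- The terms of `L`, as a structure for `withEq L` (the truth values it gives to atomic
propositions are irrelevant). -/
def termModel (L : Language) : Model (withEq L) where
  dom := fun s => Term L s
  inhab := fun _ => ⟨.var 0⟩
  interpF := fun f args => Term.func (L := L) f args
  interpP := fun _ _ => True

/-- A world of the forcing semantics: the two sides of a sequent. -/
abbrev World (L : Language) : Type := Multiset (Form L) × Multiset (Form L)

/-- The world `w'` extends the world `w`. -/
def World.Ext (w w' : World L) : Prop := w.1 ⊆ w'.1 ∧ w.2 ⊆ w'.2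

/-- A world is absurd when it is a provable sequent. -/
def World.Absurd (rs : PRS L) (w : World L) : Prop := ProvableIn rs ∅ w.1 w.2

/-- All the extensions of `w` satisfying `φ` are absurd. -/
def World.Refutes (rs : PRS L) (w : World L) (φ : World L → Prop) : Prop :=
  ∀ w', w.Ext w' → φ w' → w'.Absurd rs

theorem World.Ext.refl (w : World L) : w.Ext w := ⟨fun _ => id, fun _ => id⟩

theorem World.Ext.trans {w w' w'' : World L} (h : w.Ext w') (h' : w'.Ext w'') : w.Ext w'' :=
  ⟨fun _ hA => h'.1 (h.1 hA), fun _ hA => h'.2 (h.2 hA)⟩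

theorem World.Absurd.mono {rs : PRS L} {w w' : World L} (hw : w.Absurd rs) (h : w.Ext w') :
    w'.Absurd rs :=
  ProvableIn.mono hw h.1 h.2

theorem World.Refutes.mono {rs : PRS L} {w w' : World L} {φ : World L → Prop}
    (hw : w.Refutes rs φ) (h : w.Ext w') : w'.Refutes rs φ :=
  fun v hv => hw v (h.trans hv)

/-- The forcing relation on atomic propositions. -/
def ForcesAtom (rs : PRS L) : (p : (withEq L).Pred) →
    ((i : Fin ((withEq L).parity p).length) → (termModel L).dom (((withEq L).parity p).get i)) →
    World L → Prop
  | .inl p, args, w => ProvableIn rs ∅ w.1 (Form.pred (L := L) p args ::ₘ w.2)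
  | .inr s, args, w =>
      EqE rs s (args ⟨0, Nat.zero_lt_two⟩) (args ⟨1, Nat.one_lt_two⟩) ∨ w.Absurd rs

/-- The forcing relation. -/
def Forces (rs : PRS L) : (termModel L).Val → Form (withEq L) → World L → Prop
  | φ, .pred p args, w => ForcesAtom rs p (fun i => (termModel L).evalT φ _ (args i)) w
  | _, .bot, w => w.Absurd rs
  | _, .top, _ => True
  | φ, .not A, w => w.Refutes rs (Forces rs φ A)
  | φ, .and A B, w => Forces rs φ A w ∧ Forces rs φ B w
  | φ, .or A B, w =>
      w.Refutes rs fun w' => w'.Refutes rs (Forces rs φ A) ∧ w'.Refutes rs (Forces rs φ B)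
  | φ, .imp A B, w => ∀ w', w.Ext w' → Forces rs φ A w' → Forces rs φ B w'
  | φ, .all s A, w => ∀ d : (termModel L).dom s, Forces rs ((termModel L).push φ d) A w
  | φ, .ex s A, w =>
      w.Refutes rs fun w' =>
        ∀ d : (termModel L).dom s, w'.Refutes rs (Forces rs ((termModel L).push φ d) A)

theorem ForcesAtom.mono {rs : PRS L} {p : (withEq L).Pred}
    {args : (i : Fin ((withEq L).parity p).length) →
      (termModel L).dom (((withEq L).parity p).get i)}
    {w w' : World L} (h : w.Ext w') (hp : ForcesAtom rs p args w) : ForcesAtom rs p args w' := by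
  cases p with
  | inl p => exact ProvableIn.mono hp h.1 (Multiset.cons_subset_cons h.2)
  | inr s => exact Or.imp_right (World.Absurd.mono · h) hp

theorem ForcesAtom.of_absurd {rs : PRS L} {p : (withEq L).Pred}
    {args : (i : Fin ((withEq L).parity p).length) →
      (termModel L).dom (((withEq L).parity p).get i)}
    {w : World L} (h : w.Absurd rs) : ForcesAtom rs p args w := by
  cases p with
  | inl p => exact ProvableIn.weakR h
  | inr s => exact .inr h

theorem ForcesAtom.stable {rs : PRS L} {p : (withEq L).Pred}
    {args : (i : Fin ((withEq L).parity p).length) →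
      (termModel L).dom (((withEq L).parity p).get i)}
    {w : World L} (h : w.Refutes rs fun w' => w'.Refutes rs (ForcesAtom rs p args)) :
    ForcesAtom rs p args w := by
  cases p with
  | inl p =>
    refine h (w.1, Form.pred (L := L) p args ::ₘ w.2)
      ⟨fun _ => id, Multiset.subset_cons _ _⟩ fun w' hw' hf => ?_
    refine ProvableIn.mono hf (fun _ => id) (Multiset.cons_subset.2 ⟨?_, fun _ => id⟩)
    exact hw'.2 (Multiset.mem_cons_self _ _)
  | inr s =>
    by_cases he : EqE rs s (args ⟨0, Nat.zero_lt_two⟩) (args ⟨1, Nat.one_lt_two⟩)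
    · exact .inl he
    · exact .inr (h w (.refl w) fun w' _ hf => hf.resolve_left he)

theorem Forces.mono {rs : PRS L} {φ : (termModel L).Val} {A : Form (withEq L)}
    {w w' : World L} (h : w.Ext w') (hA : Forces rs φ A w) : Forces rs φ A w' := by
  induction A generalizing φ with
  | pred p args => exact ForcesAtom.mono h hA
  | bot => exact World.Absurd.mono hA h
  | top => trivial
  | not A ih => exact World.Refutes.mono hA h
  | and A B ihA ihB => exact ⟨ihA hA.1, ihB hA.2⟩
  | or A B ihA ihB => exact World.Refutes.mono hA h
  | imp A B ihA ihB => exact fun v hv => hA v (h.trans hv)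
  | all s A ih => exact fun t => ih (hA t)
  | ex s A ih => exact World.Refutes.mono hA h

theorem Forces.of_absurd {rs : PRS L} {φ : (termModel L).Val}
    {A : Form (withEq L)} {w : World L} (h : w.Absurd rs) : Forces rs φ A w := by
  induction A generalizing φ w with
  | pred p args => exact ForcesAtom.of_absurd h
  | bot => exact h
  | top => trivial
  | not A ih => exact fun w' hw' _ => h.mono hw'
  | and A B ihA ihB => exact ⟨ihA h, ihB h⟩
  | or A B ihA ihB => exact fun w' hw' _ => h.mono hw'
  | imp A B ihA ihB => exact fun w' hw' _ => ihB (h.mono hw')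
  | all s A ih => exact fun t => ih h
  | ex s A ih => exact fun w' hw' _ => h.mono hw'

/-- Forcing is stable under double negation. -/
theorem Forces.stable {rs : PRS L} {φ : (termModel L).Val} {A : Form (withEq L)}
    {w : World L} (h : w.Refutes rs fun w' => w'.Refutes rs (Forces rs φ A)) :
    Forces rs φ A w := by
  induction A generalizing φ w with
  | pred p args => exact ForcesAtom.stable h
  | bot => exact h w (.refl w) fun _ _ => id
  | top => trivial
  | not A ih =>
    exact fun v hv hA => h v hv fun u hu hn => hn u (.refl u) (hA.mono hu)
  | and A B ihA ihB =>
    exact ⟨ihA fun v hv hA => h v hv fun u hu hf => hA u hu hf.1,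
      ihB fun v hv hB => h v hv fun u hu hf => hB u hu hf.2⟩
  | or A B ihA ihB =>
    exact fun v hv hA => h v hv fun u hu hf => hf u (.refl u) ⟨hA.1.mono hu, hA.2.mono hu⟩
  | imp A B ihA ihB =>
    exact fun v hv hA => ihB fun u hu hB => h u (hv.trans hu) fun x hx hf =>
      hB x hx (hf x (.refl x) (hA.mono (hu.trans hx)))
  | all s A ih =>
    exact fun t => ih fun v hv hA => h v hv fun u hu hf => hA u hu (hf t)
  | ex s A ih =>
    exact fun v hv hA => h v hv fun u hu hf => hf u (.refl u) fun t => (hA t).mono hu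

theorem forces_subst {rs : PRS L} {φ : (termModel L).Val}
    {τ : (s : (withEq L).Sorts) → ℕ → Term (withEq L) s} {A : Form (withEq L)} {w : World L} :
    Forces rs φ (Form.subst τ A) w ↔
      Forces rs (fun s n => (termModel L).evalT φ s (τ s n)) A w := by
  have key : Forces rs φ (Form.subst τ A) =
      Forces rs (fun s n => (termModel L).evalT φ s (τ s n)) A := by
    induction A generalizing φ τ with
    | pred p args => funext w; simp only [Form.subst, Forces, Model.evalT_subst]
    | bot => rfl
    | top => rfl
    | not A ih => funext w; simp only [Form.subst, Forces, ih]
    | and A B ihA ihB => funext w; simp only [Form.subst, Forces, ihA, ihB]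
    | or A B ihA ihB => funext w; simp only [Form.subst, Forces, ihA, ihB]
    | imp A B ihA ihB => funext w; simp only [Form.subst, Forces, ihA, ihB]
    | all s A ih => funext w; simp only [Form.subst, Forces, ih, Model.evalT_liftSubst]
    | ex s A ih => funext w; simp only [Form.subst, Forces, ih, Model.evalT_liftSubst]
  rw [key]

theorem forces_inst {rs : PRS L} {φ : (termModel L).Val} {s₀ : (withEq L).Sorts}
    {t : Term (withEq L) s₀} {A : Form (withEq L)} {w : World L} :
    Forces rs φ (Form.inst t A) w ↔
      Forces rs ((termModel L).push φ ((termModel L).evalT φ s₀ t)) A w := by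
  rw [Form.inst, forces_subst, Model.evalT_subst0]

theorem forces_shift {rs : PRS L} {φ : (termModel L).Val} {s₀ : (withEq L).Sorts}
    {d : (termModel L).dom s₀} {A : Form (withEq L)} {w : World L} :
    Forces rs ((termModel L).push φ d) (Form.shift s₀ A) w ↔ Forces rs φ A w := by
  rw [Form.shift, Form.rename_eq_subst, forces_subst]
  exact iff_of_eq (congrArg (Forces rs · A w) (Model.push_shiftRen _ φ d))

/-! ### Soundness of predicate logic -/

theorem eq_of_eqE_emptyPRS {s : L.Sorts} {t u : Term L s} (h : EqE (emptyPRS L) s t u) :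
    t = u := by
  induction h with
  | base _ h => exact h.elim
  | refl => rfl
  | symm _ ih => exact ih.symm
  | trans _ _ ih₁ ih₂ => exact ih₁.trans ih₂
  | congr f _ ih => exact congrArg _ (funext ih)

mutual
  theorem eq_of_rwNeg_emptyPRS {A B : Form L} (h : RwNeg (emptyPRS L) A B) : A = B := by
    cases h with
    | predArg p args args' i h h' =>
      congr 1
      funext j
      by_cases hj : j = i
      · exact hj ▸ eq_of_eqE_emptyPRS h
      · exact h' j hj
    | rule _ h => exact h.elim
    | notC h => rw [eq_of_rwPos_emptyPRS h]
    | andL h => rw [eq_of_rwNeg_emptyPRS h]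
    | andR h => rw [eq_of_rwNeg_emptyPRS h]
    | orL h => rw [eq_of_rwNeg_emptyPRS h]
    | orR h => rw [eq_of_rwNeg_emptyPRS h]
    | impL h => rw [eq_of_rwPos_emptyPRS h]
    | impR h => rw [eq_of_rwNeg_emptyPRS h]
    | allC h => rw [eq_of_rwNeg_emptyPRS h]
    | exC h => rw [eq_of_rwNeg_emptyPRS h]
  theorem eq_of_rwPos_emptyPRS {A B : Form L} (h : RwPos (emptyPRS L) A B) : A = B := by
    cases h with
    | predArg p args args' i h h' =>
      congr 1
      funext j
      by_cases hj : j = i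
      · exact hj ▸ eq_of_eqE_emptyPRS h
      · exact h' j hj
    | rule _ h => exact h.elim
    | notC h => rw [eq_of_rwNeg_emptyPRS h]
    | andL h => rw [eq_of_rwPos_emptyPRS h]
    | andR h => rw [eq_of_rwPos_emptyPRS h]
    | orL h => rw [eq_of_rwPos_emptyPRS h]
    | orR h => rw [eq_of_rwPos_emptyPRS h]
    | impL h => rw [eq_of_rwNeg_emptyPRS h]
    | impR h => rw [eq_of_rwPos_emptyPRS h]
    | allC h => rw [eq_of_rwPos_emptyPRS h]
    | exC h => rw [eq_of_rwPos_emptyPRS h]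
end

theorem eq_of_rwNegS_emptyPRS {A B : Form L} (h : RwNegS (emptyPRS L) A B) : A = B := by
  induction h with
  | refl => rfl
  | tail _ h ih => exact ih.trans (eq_of_rwNeg_emptyPRS h)

theorem eq_of_rwPosS_emptyPRS {A B : Form L} (h : RwPosS (emptyPRS L) A B) : A = B := by
  induction h with
  | refl => rfl
  | tail _ h ih => exact ih.trans (eq_of_rwPos_emptyPRS h)

theorem absurd_of_pf_emptyPRS {rs : PRS L} {c : Bool} {n : ℕ}
    {Γ Δ : Multiset (Form (withEq L))} (h : Pf (emptyPRS (withEq L)) c n Γ Δ)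
    (φ : (termModel L).Val) (w : World L) (hΓ : ∀ A ∈ Γ, Forces rs φ A w)
    (hΔ : ∀ B ∈ Δ, w.Refutes rs (Forces rs φ B)) : w.Absurd rs := by
  have monoΓ {Γ : Multiset (Form (withEq L))} {φ : (termModel L).Val} {w v : World L}
      (hv : w.Ext v) (h : ∀ A ∈ Γ, Forces rs φ A w) : ∀ A ∈ Γ, Forces rs φ A v :=
    fun A hA => (h A hA).mono hv
  have monoΔ {Δ : Multiset (Form (withEq L))} {φ : (termModel L).Val} {w v : World L}
      (hv : w.Ext v) (h : ∀ B ∈ Δ, w.Refutes rs (Forces rs φ B)) :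
      ∀ B ∈ Δ, v.Refutes rs (Forces rs φ B) :=
    fun B hB => (h B hB).mono hv
  have shiftΓ {Γ : Multiset (Form (withEq L))} {φ : (termModel L).Val} {w : World L}
      {s : (withEq L).Sorts} (d : (termModel L).dom s) (h : ∀ A ∈ Γ, Forces rs φ A w) :
      ∀ A ∈ Γ.map (Form.shift s), Forces rs ((termModel L).push φ d) A w := by
    intro A hA
    obtain ⟨A, hA', rfl⟩ := Multiset.mem_map.1 hA
    exact forces_shift.2 (h A hA')
  have shiftΔ {Δ : Multiset (Form (withEq L))} {φ : (termModel L).Val} {w : World L}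
      {s : (withEq L).Sorts} (d : (termModel L).dom s)
      (h : ∀ B ∈ Δ, w.Refutes rs (Forces rs φ B)) :
      ∀ B ∈ Δ.map (Form.shift s), w.Refutes rs (Forces rs ((termModel L).push φ d) B) := by
    intro B hB
    obtain ⟨B, hB', rfl⟩ := Multiset.mem_map.1 hB
    exact fun v hv hf => h B hB' v hv (forces_shift.1 hf)
  induction h generalizing φ w with
  | ax hP hA hB =>
    rw [eq_of_rwNegS_emptyPRS hA] at hΓ
    rw [eq_of_rwPosS_emptyPRS hB] at hΔ
    exact hΔ _ (Multiset.mem_singleton_self _) w (.refl w) (hΓ _ (Multiset.mem_singleton_self _))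
  | cut _ hB hC _ _ ihL ihR =>
    obtain rfl := eq_of_rwNegS_emptyPRS hB
    obtain rfl := eq_of_rwPosS_emptyPRS hC
    refine ihR φ w hΓ (Multiset.forall_mem_cons.2 ⟨fun v hv hf => ?_, hΔ⟩)
    exact ihL φ v (Multiset.forall_mem_cons.2 ⟨hf, monoΓ hv hΓ⟩) (monoΔ hv hΔ)
  | contrL hB hC _ ih =>
    obtain rfl := eq_of_rwNegS_emptyPRS hB
    obtain rfl := eq_of_rwNegS_emptyPRS hC
    rw [Multiset.forall_mem_cons] at hΓ
    exact ih φ w (by simpa only [Multiset.forall_mem_cons] using ⟨hΓ.1, hΓ⟩) hΔ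
  | contrR hB hC _ ih =>
    obtain rfl := eq_of_rwPosS_emptyPRS hB
    obtain rfl := eq_of_rwPosS_emptyPRS hC
    rw [Multiset.forall_mem_cons] at hΔ
    exact ih φ w hΓ (by simpa only [Multiset.forall_mem_cons] using ⟨hΔ.1, hΔ⟩)
  | weakL _ ih => exact ih φ w (Multiset.forall_mem_cons.1 hΓ).2 hΔ
  | weakR _ ih => exact ih φ w hΓ (Multiset.forall_mem_cons.1 hΔ).2
  | topR hA =>
    obtain rfl := eq_of_rwPosS_emptyPRS hA
    exact hΔ _ (Multiset.mem_cons_self _ _) w (.refl w) trivial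
  | botL hA =>
    obtain rfl := eq_of_rwNegS_emptyPRS hA
    exact hΓ _ (Multiset.mem_cons_self _ _)
  | notL hA _ ih =>
    obtain rfl := eq_of_rwNegS_emptyPRS hA
    rw [Multiset.forall_mem_cons] at hΓ
    exact ih φ w hΓ.2 (Multiset.forall_mem_cons.2 ⟨hΓ.1, hΔ⟩)
  | notR hA _ ih =>
    obtain rfl := eq_of_rwPosS_emptyPRS hA
    rw [Multiset.forall_mem_cons] at hΔ
    refine hΔ.1 w (.refl w) fun v hv hf => ?_
    exact ih φ v (Multiset.forall_mem_cons.2 ⟨hf, monoΓ hv hΓ⟩) (monoΔ hv hΔ.2)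
  | andL hA _ ih =>
    obtain rfl := eq_of_rwNegS_emptyPRS hA
    rw [Multiset.forall_mem_cons] at hΓ
    exact ih φ w (Multiset.forall_mem_cons.2
      ⟨hΓ.1.1, Multiset.forall_mem_cons.2 ⟨hΓ.1.2, hΓ.2⟩⟩) hΔ
  | andR hA _ _ ih₁ ih₂ =>
    obtain rfl := eq_of_rwPosS_emptyPRS hA
    rw [Multiset.forall_mem_cons] at hΔ
    refine ih₁ φ w hΓ (Multiset.forall_mem_cons.2 ⟨fun v hv hB => ?_, hΔ.2⟩)
    refine ih₂ φ v (monoΓ hv hΓ) (Multiset.forall_mem_cons.2 ⟨fun u hu hC => ?_, monoΔ hv hΔ.2⟩)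
    exact hΔ.1 u (hv.trans hu) ⟨hB.mono hu, hC⟩
  | orL hA _ _ ih₁ ih₂ =>
    obtain rfl := eq_of_rwNegS_emptyPRS hA
    rw [Multiset.forall_mem_cons] at hΓ
    exact hΓ.1 w (.refl w)
      ⟨fun v hv hB => ih₁ φ v (Multiset.forall_mem_cons.2 ⟨hB, monoΓ hv hΓ.2⟩) (monoΔ hv hΔ),
        fun v hv hC => ih₂ φ v (Multiset.forall_mem_cons.2 ⟨hC, monoΓ hv hΓ.2⟩) (monoΔ hv hΔ)⟩
  | orR hA _ ih =>
    obtain rfl := eq_of_rwPosS_emptyPRS hA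
    rw [Multiset.forall_mem_cons] at hΔ
    refine ih φ w hΓ (Multiset.forall_mem_cons.2 ⟨fun v hv hB => ?_,
      Multiset.forall_mem_cons.2 ⟨fun v hv hC => ?_, hΔ.2⟩⟩)
    · exact hΔ.1 v hv fun u hu hn => hn.1 u (.refl u) (hB.mono hu)
    · exact hΔ.1 v hv fun u hu hn => hn.2 u (.refl u) (hC.mono hu)
  | impL hA _ _ ih₁ ih₂ =>
    obtain rfl := eq_of_rwNegS_emptyPRS hA
    rw [Multiset.forall_mem_cons] at hΓ
    refine ih₁ φ w hΓ.2 (Multiset.forall_mem_cons.2 ⟨fun v hv hB => ?_, hΔ⟩)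
    exact ih₂ φ v (Multiset.forall_mem_cons.2 ⟨hΓ.1 v hv hB, monoΓ hv hΓ.2⟩) (monoΔ hv hΔ)
  | impR hA _ ih =>
    obtain rfl := eq_of_rwPosS_emptyPRS hA
    rw [Multiset.forall_mem_cons] at hΔ
    refine hΔ.1 w (.refl w) fun v hv hB => Forces.stable fun u hu hC => ?_
    exact ih φ u (Multiset.forall_mem_cons.2 ⟨hB.mono hu, monoΓ (hv.trans hu) hΓ⟩)
      (Multiset.forall_mem_cons.2 ⟨hC, monoΔ (hv.trans hu) hΔ.2⟩)
  | allL hA hC _ ih =>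
    obtain rfl := eq_of_rwNegS_emptyPRS hA
    obtain rfl := eq_of_rwNegS_emptyPRS hC
    rw [Multiset.forall_mem_cons] at hΓ
    exact ih φ w (Multiset.forall_mem_cons.2 ⟨forces_inst.2 (hΓ.1 _), hΓ.2⟩) hΔ
  | allR hA _ ih =>
    obtain rfl := eq_of_rwPosS_emptyPRS hA
    rw [Multiset.forall_mem_cons] at hΔ
    refine hΔ.1 w (.refl w) fun d => Forces.stable fun v hv hB => ?_
    exact ih _ v (shiftΓ d (monoΓ hv hΓ))
      (Multiset.forall_mem_cons.2 ⟨hB, shiftΔ d (monoΔ hv hΔ.2)⟩)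
  | exL hA _ ih =>
    obtain rfl := eq_of_rwNegS_emptyPRS hA
    rw [Multiset.forall_mem_cons] at hΓ
    refine hΓ.1 w (.refl w) fun d v hv hB => ?_
    exact ih _ v (Multiset.forall_mem_cons.2 ⟨hB, shiftΓ d (monoΓ hv hΓ.2)⟩)
      (shiftΔ d (monoΔ hv hΔ))
  | exR hA hC _ ih =>
    obtain rfl := eq_of_rwPosS_emptyPRS hA
    obtain rfl := eq_of_rwPosS_emptyPRS hC
    rw [Multiset.forall_mem_cons] at hΔ
    refine ih φ w hΓ (Multiset.forall_mem_cons.2 ⟨fun v hv hC => ?_, hΔ.2⟩)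
    exact hΔ.1 v hv fun u hu hn => hn _ u (.refl u) ((forces_inst.1 hC).mono hu)

/-! ### Forcing the propositions of the original language -/

theorem evalT_toEq (σ : (s : L.Sorts) → ℕ → Term L s) {s : L.Sorts} (t : Term L s) :
    (termModel L).evalT σ s (Term.toEq s t) = Term.subst σ s t := by
  induction t with
  | var n => rfl
  | func f args ih => exact congrArg (Term.func (L := L) f) (funext ih)

theorem forces_toEq {rs : PRS L} {σ : (s : L.Sorts) → ℕ → Term L s} {A : Form L} {w : World L} :
    Forces rs σ A.toEq w ↔ ProvableIn rs ∅ w.1 (Form.subst σ A ::ₘ w.2) := by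
  have ident {Γ Δ : Multiset (Form L)} {A : Form L} : ProvableIn rs ∅ (A ::ₘ Γ) (A ::ₘ Δ) :=
    .ident shiftInvariant_empty
  induction A generalizing σ w with
  | pred p args =>
    refine iff_of_eq (congrArg (fun args => ProvableIn rs ∅ w.1 (Form.pred p args ::ₘ w.2)) ?_)
    exact funext fun i => evalT_toEq σ (args i)
  | bot => exact ⟨.weakR, .cut .botL⟩
  | top => exact ⟨fun _ => .topR, fun _ => trivial⟩
  | not A ih =>
    refine ⟨fun h => .notR (h (_ ::ₘ w.1, w.2) ⟨Multiset.subset_cons _ _, fun _ => id⟩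
      (ih.2 ident)), fun h w' hw' hA => ?_⟩
    exact .cut (.notL (ih.1 hA)) (h.mono hw'.1 (Multiset.cons_subset_cons hw'.2))
  | and A B ihA ihB =>
    refine ⟨fun h => .andR (ihA.1 h.1) (ihB.1 h.2), fun h => ⟨ihA.2 ?_, ihB.2 ?_⟩⟩
    · exact .right_of_entails (.andL ident) h
    · exact .right_of_entails (.andL (.swapL ident)) h
  | or A B ihA ihB =>
    refine ⟨fun h => .orR (h (w.1, _ ::ₘ _ ::ₘ w.2) ⟨fun _ => id, ?_⟩ ⟨?_, ?_⟩),
      fun h w' hw' hn => ?_⟩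
    · exact fun C hC => by simp [hC]
    · exact fun v hv hA => (ihA.1 hA).mono (fun _ => id)
        (Multiset.cons_subset.2 ⟨hv.2 (by simp), fun _ => id⟩)
    · exact fun v hv hB => (ihB.1 hB).mono (fun _ => id)
        (Multiset.cons_subset.2 ⟨hv.2 (by simp), fun _ => id⟩)
    · exact .cut (.orL
          (hn.1 (_ ::ₘ w'.1, w'.2) ⟨Multiset.subset_cons _ _, fun _ => id⟩ (ihA.2 ident))
          (hn.2 (_ ::ₘ w'.1, w'.2) ⟨Multiset.subset_cons _ _, fun _ => id⟩ (ihB.2 ident)))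
        (h.mono hw'.1 (Multiset.cons_subset_cons hw'.2))
  | imp A B ihA ihB =>
    refine ⟨fun h => .impR (ihB.1 (h (_ ::ₘ w.1, w.2) ⟨Multiset.subset_cons _ _, fun _ => id⟩
      (ihA.2 ident))), fun h w' hw' hA => ihB.2 ?_⟩
    refine .cut (.impL ((ihA.1 hA).weakR.swapR) ident) ?_
    exact (h.mono hw'.1 (Multiset.cons_subset_cons hw'.2)).weakR.swapR
  | all s A ih =>
    refine ⟨fun h => .allR_of_forall_inst fun t => ?_, fun h (t : Term L s) => ih.2 ?_⟩
    · rw [inst_subst_liftSubst]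
      exact ih.1 (h t)
    · refine .right_of_entails ?_ h
      have := ProvableIn.entails_inst (rs := rs) (A := Form.subst (liftSubst s σ) A)
        shiftInvariant_empty t
      rwa [inst_subst_liftSubst] at this
  | ex s A ih =>
    refine ⟨fun h => ?_, fun h w' hw' hn => ?_⟩
    · have := h (w.1, Form.subst σ (.ex s A) ::ₘ w.2) ⟨fun _ => id, Multiset.subset_cons _ _⟩
        fun (t : Term L s) v hv hA => ?_
      · exact this
      · have ha := ih.1 hA
        have hi : ProvableIn rs ∅ _ _ := .inst_entails (rs := rs)
          (A := Form.subst (liftSubst s σ) A) shiftInvariant_empty t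
        rw [inst_subst_liftSubst] at hi
        exact (ProvableIn.right_of_entails hi ha).mono (fun _ => id)
          (Multiset.cons_subset.2 ⟨hv.2 (Multiset.mem_cons_self _ _), fun _ => id⟩)
    · refine .cut (.exL_of_forall_inst fun t => ?_)
        (h.mono hw'.1 (Multiset.cons_subset_cons hw'.2))
      rw [inst_subst_liftSubst]
      exact hn t (_ ::ₘ w'.1, w'.2) ⟨Multiset.subset_cons _ _, fun _ => id⟩ (ih.2 ident)

/-! ### Forcing the axioms -/

theorem forces_univClosure {rs : PRS L} {A : Form (withEq L)} {w : World L}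
    (h : ∀ φ, Forces rs φ A w) (φ : (termModel L).Val) : Forces rs φ (univClosure A) w := by
  unfold univClosure
  generalize A.freeList.length = n
  induction n generalizing A with
  | zero => exact h φ
  | succ n ih =>
    rw [closeSteps]
    split
    · exact h φ
    · exact ih fun φ d => forces_subst.2 (h _)

theorem forces_of_mem_foldr_and {rs : PRS L} {φ : (termModel L).Val} {w : World L} {ι : Type}
    {F : ι → Form (withEq L)} {l : List ι}
    (h : Forces rs φ (l.foldr (fun i C => .and (F i) C) .top) w) :
    ∀ i ∈ l, Forces rs φ (F i) w := by
  induction l with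
  | nil => simp
  | cons a l ih => exact List.forall_mem_cons.2 ⟨h.1, ih h.2⟩

theorem forces_eqForm {rs : PRS L} {φ : (termModel L).Val} {w : World L} {s : L.Sorts}
    {t u : Term (withEq L) s} :
    Forces rs φ (eqForm t u) w ↔
      EqE rs s ((termModel L).evalT φ s t) ((termModel L).evalT φ s u) ∨ w.Absurd rs :=
  Iff.rfl

theorem forces_funcCongrAx {rs : PRS L} (f : L.Func) (φ : (termModel L).Val) (w : World L) :
    Forces rs φ (funcCongrAx f) w := by
  refine forces_univClosure (fun φ => ?_) φ
  intro w' _ h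
  by_cases hw : w'.Absurd rs
  · exact .of_absurd hw
  · refine .inl (.congr f fun i => ?_)
    exact (forces_of_mem_foldr_and h i (List.mem_finRange i)).resolve_right hw

theorem ForcesAtom.congr {rs : PRS L} {p : (withEq L).Pred}
    {args args' : (i : Fin ((withEq L).parity p).length) →
      (termModel L).dom (((withEq L).parity p).get i)}
    {w : World L} (h : ∀ i, EqE rs _ (args i) (args' i)) (hp : ForcesAtom rs p args w) :
    ForcesAtom rs p args' w := by
  cases p with
  | inl p => exact .right_of_entails (rwNegS_pred p h).entails hp
  | inr s =>
    exact hp.imp_left fun he => (h ⟨0, Nat.zero_lt_two⟩).symm.trans (he.trans (h ⟨1, Nat.one_lt_two⟩))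

theorem forces_predCongrAx {rs : PRS L} (p : (withEq L).Pred) (φ : (termModel L).Val)
    (w : World L) : Forces rs φ (predCongrAx p) w := by
  refine forces_univClosure (fun φ => ?_) φ
  intro w' _ h w'' hw'' hp
  by_cases hw : w''.Absurd rs
  · exact .of_absurd hw
  · refine ForcesAtom.congr (fun i => ?_) hp
    exact (forces_of_mem_foldr_and (h.mono hw'') i (List.mem_finRange i)).resolve_right hw

theorem forces_of_mem_URset {rs : PRS L} {A : Form (withEq L)} (hA : A ∈ URset rs.toEq)
    (φ : (termModel L).Val) (w : World L) : Forces rs φ A w := by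
  obtain ((((((⟨s, rfl⟩ | ⟨s, rfl⟩) | ⟨s, rfl⟩) | ⟨f, rfl⟩) | ⟨p, rfl⟩) |
    ⟨s, _, _, ⟨t, u, h, rfl, rfl⟩, rfl⟩) | ⟨_, _, ⟨P, A, h, rfl, rfl⟩, rfl⟩) |
    ⟨_, _, ⟨P, A, h, rfl, rfl⟩, rfl⟩ := hA
  · exact forces_univClosure (fun φ => forces_eqForm.2 (.inl (.refl _))) φ
  · refine forces_univClosure (fun φ => ?_) φ
    exact fun w' _ h => forces_eqForm.2 ((forces_eqForm.1 h).imp_left .symm)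
  · refine forces_univClosure (fun φ => ?_) φ
    exact fun w' _ h => forces_eqForm.2 <|
      (forces_eqForm.1 h.1).elim (fun h₁ => (forces_eqForm.1 h.2).imp_left h₁.trans) .inr
  · exact forces_funcCongrAx f φ w
  · exact forces_predCongrAx p φ w
  · refine forces_univClosure (fun φ => forces_eqForm.2 (.inl ?_)) φ
    exact (congrArg₂ (EqE rs s) (evalT_toEq φ t) (evalT_toEq φ u)).mpr (.base φ h)
  · refine forces_univClosure (fun φ => ?_) φ
    refine fun w' _ hP => forces_toEq.2 ?_
    exact .right_of_entails (RwNegS.entails (.single (.rule φ h))) (forces_toEq.1 hP)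
  · refine forces_univClosure (fun φ => ?_) φ
    refine fun w' _ hA => forces_toEq.2 ?_
    exact .right_of_entails (RwPosS.entails (.single (.rule φ h))) (forces_toEq.1 hA)

theorem forces_var_toEq {rs : PRS L} {A : Form L} {w : World L} :
    Forces rs (fun _ n => Term.var (L := L) n) A.toEq w ↔
      ProvableIn rs ∅ w.1 (A ::ₘ w.2) := by
  have h := forces_toEq (rs := rs) (σ := fun _ n => .var n) (A := A) (w := w)
  rwa [Form.subst_var] at h

theorem provable_of_provable_from_UR {rs : PRS L} {Γ Δ : Multiset (Form L)}
    (h : PLProvableIn (URset rs.toEq) (Γ.map Form.toEq) (Δ.map Form.toEq)) :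
    Provable rs Γ Δ := by
  obtain ⟨T, hT, n, hn⟩ := h
  have : World.Absurd rs (Γ, Δ) := by
    refine absurd_of_pf_emptyPRS hn (fun _ n => Term.var (L := L) n) _ (fun A hA => ?_)
      fun B hB w hw hf => ?_
    · obtain hA | hA := Multiset.mem_add.1 hA
      · obtain ⟨A, hA', rfl⟩ := Multiset.mem_map.1 hA
        exact forces_var_toEq.2 <| (ProvableIn.entails_refl shiftInvariant_empty A).mono
          (Multiset.singleton_subset.2 hA') (by simp)
      · exact forces_of_mem_URset (hT A hA) _ _
    · obtain ⟨B, hB', rfl⟩ := Multiset.mem_map.1 hB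
      exact (forces_var_toEq.1 hf).mono (fun _ => id)
        (Multiset.cons_subset.2 ⟨hw.2 hB', fun _ => id⟩)
  exact this.provable

/-! ### Deriving the rewriting steps from the axioms -/

theorem Term.toEq_subst (σ : (s : L.Sorts) → ℕ → Term L s) {s : L.Sorts} (t : Term L s) :
    Term.toEq s (Term.subst σ s t) =
      Term.subst (L := withEq L) (fun s n => Term.toEq (L := L) s (σ s n)) s (Term.toEq s t) := by
  induction t with
  | var n => rfl
  | func f args ih => exact congrArg (Term.func (L := withEq L) f) (funext ih)

theorem Term.toEq_rename (ρ : (s : L.Sorts) → ℕ → ℕ) {s : L.Sorts} (t : Term L s) :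
    Term.toEq s (Term.rename ρ s t) = Term.rename (L := withEq L) ρ s (Term.toEq s t) := by
  induction t with
  | var n => rfl
  | func f args ih => exact congrArg (Term.func (L := withEq L) f) (funext ih)

theorem Form.toEq_rename (ρ : (s : L.Sorts) → ℕ → ℕ) (A : Form L) :
    (Form.rename ρ A).toEq = Form.rename (L := withEq L) ρ A.toEq := by
  induction A generalizing ρ with
  | pred p args =>
    exact congrArg (Form.pred (L := withEq L) (.inl p))
      (funext fun i => Term.toEq_rename ρ (args i))
  | bot => rfl
  | top => rfl
  | not A ih => exact congrArg Form.not (ih ρ)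
  | and A B ihA ihB => exact congrArg₂ Form.and (ihA ρ) (ihB ρ)
  | or A B ihA ihB => exact congrArg₂ Form.or (ihA ρ) (ihB ρ)
  | imp A B ihA ihB => exact congrArg₂ Form.imp (ihA ρ) (ihB ρ)
  | all s A ih => exact congrArg (Form.all (L := withEq L) s) (ih _)
  | ex s A ih => exact congrArg (Form.ex (L := withEq L) s) (ih _)

theorem toEq_liftSubst (s₀ : L.Sorts) (σ : (s : L.Sorts) → ℕ → Term L s) :
    (fun s n => Term.toEq s (liftSubst s₀ σ s n)) =
      liftSubst (L := withEq L) s₀ fun s n => Term.toEq (L := L) s (σ s n) := by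
  funext s n
  unfold liftSubst
  by_cases h : s = s₀
  · subst h
    rw [if_pos rfl]
    refine Eq.trans ?_ (if_pos (α := Term (withEq L) s) rfl).symm
    cases n
    · rfl
    · exact Term.toEq_rename _ _
  · rw [if_neg h]
    exact (Term.toEq_rename _ _).trans (if_neg (α := Term (withEq L) s) h).symm

theorem Form.toEq_subst (σ : (s : L.Sorts) → ℕ → Term L s) (A : Form L) :
    (Form.subst σ A).toEq =
      Form.subst (L := withEq L) (fun s n => Term.toEq (L := L) s (σ s n)) A.toEq := by
  induction A generalizing σ with
  | pred p args =>
    exact congrArg (Form.pred (L := withEq L) (.inl p))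
      (funext fun i => Term.toEq_subst σ (args i))
  | bot => rfl
  | top => rfl
  | not A ih => exact congrArg Form.not (ih σ)
  | and A B ihA ihB => exact congrArg₂ Form.and (ihA σ) (ihB σ)
  | or A B ihA ihB => exact congrArg₂ Form.or (ihA σ) (ihB σ)
  | imp A B ihA ihB => exact congrArg₂ Form.imp (ihA σ) (ihB σ)
  | all s A ih =>
    exact congrArg (Form.all (L := withEq L) s) ((ih _).trans
      (congrArg (fun σ => Form.subst (L := withEq L) σ A.toEq) (toEq_liftSubst s σ)))
  | ex s A ih =>
    exact congrArg (Form.ex (L := withEq L) s) ((ih _).trans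
      (congrArg (fun σ => Form.subst (L := withEq L) σ A.toEq) (toEq_liftSubst s σ)))

theorem Form.toEq_inst {s : L.Sorts} (t : Term L s) (A : Form L) :
    (Form.inst t A).toEq = Form.inst (L := withEq L) (Term.toEq s t) A.toEq := by
  refine (Form.toEq_subst (subst0 t) A).trans
    (congrArg (fun σ => Form.subst (L := withEq L) σ A.toEq) ?_)
  funext s' n
  unfold subst0
  by_cases h : s = s'
  · subst h
    rw [dif_pos rfl]
    refine Eq.trans ?_ (dif_pos (α := Term (withEq L) s) rfl).symm
    cases n <;> rfl
  · rw [dif_neg h]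
    refine Eq.trans ?_ (dif_neg (c := s = s') h).symm
    rfl

theorem Multiset.map_toEq_shift (s : L.Sorts) (Γ : Multiset (Form L)) :
    (Γ.map (Form.shift s)).map Form.toEq =
      (Γ.map Form.toEq).map (Form.shift (L := withEq L) s) := by
  rw [Multiset.map_map, Multiset.map_map]
  exact Multiset.map_congr rfl fun A _ => Form.toEq_rename _ A

theorem closeSteps_entails {rs : PRS L} {T : Set (Form L)} (hT : ShiftInvariant T)
    (σ : (s : L.Sorts) → ℕ → Term L s) (n : ℕ) (A : Form L) (h : A.freeList.length ≤ n) :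
    ProvableIn rs T {closeSteps n A} {Form.subst σ A} := by
  induction n generalizing A with
  | zero =>
    rw [Form.subst_of_freeList_eq_nil (List.length_eq_zero_iff.1 (Nat.le_zero.1 h))]
    exact .entails_refl hT A
  | succ n ih =>
    rw [closeSteps]
    split
    · rw [Form.subst_of_freeList_eq_nil (by assumption)]
      exact .entails_refl hT A
    · rename_i v l hv
      obtain ⟨s, k⟩ := v
      have hl : (A.abstractVar s k).freeList.length ≤ n := by
        rw [Form.freeList_abstractVar, hv]
        have := List.length_filter_le (fun w => decide ¬(w = ⟨s, k⟩)) l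
        simp [hv] at h this ⊢
        omega
      refine .entails_trans (ih _ hl) ?_
      have key := ProvableIn.entails_inst (rs := rs) hT
        (A := Form.subst (liftSubst s σ) (Form.rename (abstractRen s k) A)) (σ s k)
      have hσ : (fun s' n => pushTerm σ (σ s k) s' (abstractRen s k s' n)) = σ := by
        funext s' n
        by_cases hs : s = s'
        · subst hs
          by_cases hn : n = k <;> simp [abstractRen, pushTerm, hn]
        · simp [abstractRen, pushTerm, hs, Ne.symm hs]
      rw [inst_subst_liftSubst, Form.subst_rename (pushTerm σ (σ s k)), hσ] at key
      rw [Form.abstractVar_eq_rename]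
      exact key

namespace ProvableIn

variable {rs : PRS L} {T : Set (Form L)} {A B : Form L}

theorem subst_of_univClosure_mem (hT : ShiftInvariant T) (h : univClosure A ∈ T)
    (σ : (s : L.Sorts) → ℕ → Term L s) : ProvableIn rs T 0 {Form.subst σ A} := by
  obtain ⟨T', hT', hp⟩ := closeSteps_entails (rs := rs) hT σ _ A le_rfl
  exact ⟨univClosure A ::ₘ T', Multiset.forall_mem_cons.2 ⟨h, hT'⟩, by
    rwa [zero_add, ← Multiset.singleton_add]⟩

theorem entails_of_imp (hT : ShiftInvariant T) (h : ProvableIn rs T 0 {.imp A B}) :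
    ProvableIn rs T {A} {B} := by
  refine cut (A := .imp A B) (impL ?_ ?_) (h.mono (by simp) (by simp))
  · exact ident hT
  · exact ident hT

theorem of_entails (h : ProvableIn rs T {A} {B}) (hA : ProvableIn rs T 0 {A}) :
    ProvableIn rs T 0 {B} :=
  right_of_entails h hA

theorem subst_foldr_and {ι : Type} {F : ι → Form L} {σ : (s : L.Sorts) → ℕ → Term L s}
    (l : List ι) (h : ∀ i, ProvableIn rs T 0 {Form.subst σ (F i)}) :
    ProvableIn rs T 0 {Form.subst σ (l.foldr (fun i C => .and (F i) C) .top)} := by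
  induction l with
  | nil => exact topR
  | cons i l ih => exact andR (h i) ih

end ProvableIn

theorem exists_subst_var_even_odd {l : List L.Sorts}
    (a b : (i : Fin l.length) → Term L (l.get i)) :
    ∃ σ : (s : L.Sorts) → ℕ → Term L s,
      ∀ i, σ (l.get i) (2 * i.val) = a i ∧ σ (l.get i) (2 * i.val + 1) = b i := by
  let f (x : Fin l.length × Bool) : (_ : L.Sorts) × ℕ :=
    ⟨l.get x.1, if x.2 then 2 * x.1.val else 2 * x.1.val + 1⟩
  let g (x : Fin l.length × Bool) : Term L (f x).1 := if x.2 then a x.1 else b x.1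
  have hf : Function.Injective f := by
    rintro ⟨i, x⟩ ⟨j, y⟩ h
    have := congrArg Sigma.snd h
    rw [Prod.mk.injEq, Fin.ext_iff]
    cases x <;> cases y <;> simp [f] at this ⊢ <;> omega
  let σ (v : (_ : L.Sorts) × ℕ) : Term L v.1 :=
    if h : ∃ x, f x = v then h.choose_spec ▸ g h.choose else .var 0
  have hσ (x) : σ (f x) = g x := by
    have h : ∃ y, f y = f x := ⟨x, rfl⟩
    simp only [σ, dif_pos h]
    have hg {y} (e : f y = f x) : (e ▸ g y : Term L (f x).1) = g x := by
      obtain rfl := hf e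
      rfl
    exact hg h.choose_spec
  exact ⟨fun s n => σ ⟨s, n⟩, fun i => ⟨hσ (i, true), hσ (i, false)⟩⟩

theorem subst_func_var {σ : (s : L.Sorts) → ℕ → Term L s} {f : L.Func}
    {k : Fin (L.arity f).length → ℕ}
    {a : (i : Fin (L.arity f).length) → Term L ((L.arity f).get i)}
    (h : ∀ i, σ _ (k i) = a i) :
    Term.subst σ _ (.func f fun i => .var (k i)) = .func f a :=
  congrArg (Term.func f) (funext h)

theorem subst_eqForm {σ : (s : (withEq L).Sorts) → ℕ → Term (withEq L) s} {s : L.Sorts}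
    {t t' u u' : Term (withEq L) s} (ht : Term.subst (L := withEq L) σ s t = t')
    (hu : Term.subst (L := withEq L) σ s u = u') :
    Form.subst (L := withEq L) σ (eqForm t u) = eqForm t' u' := by
  subst ht hu
  refine congrArg (Form.pred (L := withEq L) (.inr s)) (funext fun i => ?_)
  match i with
  | ⟨0, _⟩ => rfl
  | ⟨1, _⟩ => rfl

theorem subst_eqForm_var {σ : (s : (withEq L).Sorts) → ℕ → Term (withEq L) s} {s : L.Sorts}
    {m n : ℕ} {t u : Term (withEq L) s} (ht : σ s m = t) (hu : σ s n = u) :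
    Form.subst (L := withEq L) σ (eqForm (s := s) (.var m) (.var n)) = eqForm t u :=
  subst_eqForm (σ := σ) (t := .var m) (u := .var n) ht hu

theorem shiftInvariant_URset (rs : PRS (withEq L)) : ShiftInvariant (URset rs) := by
  intro C hC s
  suffices ∃ A, C = univClosure A by
    obtain ⟨A, rfl⟩ := this
    exact Form.shift_univClosure s A
  obtain ((((((⟨s, rfl⟩ | ⟨s, rfl⟩) | ⟨s, rfl⟩) | ⟨f, rfl⟩) | ⟨p, rfl⟩) |
    ⟨s, t, u, h, rfl⟩) | ⟨P, A, h, rfl⟩) | ⟨P, A, h, rfl⟩ := hC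
  all_goals exact ⟨_, rfl⟩

theorem exists_subst_sort (s : L.Sorts) (f : ℕ → Term L s) :
    ∃ σ : (s : L.Sorts) → ℕ → Term L s, ∀ n, σ s n = f n :=
  ⟨fun s' n => if h : s = s' then h ▸ f n else .var n, fun _ => dif_pos rfl⟩

/-- Provability in predicate logic of a proposition from the axioms `U_R`. -/
abbrev URProvable (rs : PRS (withEq L)) (A : Form (withEq L)) : Prop :=
  ProvableIn (emptyPRS (withEq L)) (URset rs) 0 {A}

namespace URProvable

variable {rs : PRS (withEq L)} {s : L.Sorts} {t u v : Term (withEq L) s}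

theorem subst_of_mem {A : Form (withEq L)} (h : univClosure A ∈ URset rs)
    (σ : (s : (withEq L).Sorts) → ℕ → Term (withEq L) s) :
    URProvable rs (Form.subst σ A) :=
  ProvableIn.subst_of_univClosure_mem (shiftInvariant_URset rs) h σ

theorem mp {A B : Form (withEq L)} (h : URProvable rs (.imp A B)) (hA : URProvable rs A) :
    URProvable rs B :=
  (ProvableIn.entails_of_imp (shiftInvariant_URset rs) h).of_entails hA

theorem and {A B : Form (withEq L)} (hA : URProvable rs A) (hB : URProvable rs B) :
    URProvable rs (.and A B) :=
  ProvableIn.andR hA hB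

theorem eq_refl (t : Term (withEq L) s) : URProvable rs (eqForm t t) := by
  obtain ⟨σ, hσ⟩ := exists_subst_sort (L := withEq L) s fun _ => t
  have h := subst_of_mem (rs := rs) (A := eqForm (s := s) (.var 0) (.var 0))
    (.inl <| .inl <| .inl <| .inl <| .inl <| .inl <| .inl ⟨s, rfl⟩) σ
  have e := subst_eqForm_var (L := L) (hσ 0) (hσ 0)
  exact e ▸ h

theorem eq_symm (h : URProvable rs (eqForm t u)) : URProvable rs (eqForm u t) := by
  obtain ⟨σ, hσ⟩ := exists_subst_sort (L := withEq L) s fun n => if n = 0 then t else u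
  have hax := subst_of_mem (rs := rs)
    (A := (eqForm (s := s) (.var 0) (.var 1)).imp (eqForm (s := s) (.var 1) (.var 0)))
    (.inl <| .inl <| .inl <| .inl <| .inl <| .inl <| .inr ⟨s, rfl⟩) σ
  have e₁ := subst_eqForm_var (L := L) (hσ 0) (hσ 1)
  have e₂ := subst_eqForm_var (L := L) (hσ 1) (hσ 0)
  exact mp (congrArg₂ Form.imp e₁ e₂ ▸ hax) h

theorem eq_trans (h₁ : URProvable rs (eqForm t u)) (h₂ : URProvable rs (eqForm u v)) :
    URProvable rs (eqForm t v) := by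
  obtain ⟨σ, hσ⟩ := exists_subst_sort (L := withEq L) s fun n =>
    if n = 0 then t else if n = 1 then u else v
  have hax := subst_of_mem (rs := rs)
    (A := (Form.and (eqForm (s := s) (.var 0) (.var 1)) (eqForm (s := s) (.var 1) (.var 2))).imp
      (eqForm (s := s) (.var 0) (.var 2)))
    (.inl <| .inl <| .inl <| .inl <| .inl <| .inr ⟨s, rfl⟩) σ
  have e₁ := subst_eqForm_var (L := L) (hσ 0) (hσ 1)
  have e₂ := subst_eqForm_var (L := L) (hσ 1) (hσ 2)
  have e₃ := subst_eqForm_var (L := L) (hσ 0) (hσ 2)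
  exact mp (congrArg₂ Form.imp (congrArg₂ Form.and e₁ e₂) e₃ ▸ hax) (h₁.and h₂)

theorem eq_func (f : L.Func)
    {a b : (i : Fin (L.arity f).length) → Term (withEq L) ((L.arity f).get i)}
    (h : ∀ i, URProvable rs (eqForm (a i) (b i))) :
    URProvable rs (eqForm (Term.func (L := withEq L) f a) (Term.func (L := withEq L) f b)) := by
  obtain ⟨σ, hσ⟩ := exists_subst_var_even_odd (L := withEq L) a b
  have hax := subst_of_mem (rs := rs) (A := (congrHypF f).imp _)
    (.inl <| .inl <| .inl <| .inl <| .inr ⟨f, rfl⟩) σ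
  have e := subst_eqForm (L := L) (subst_func_var (L := withEq L) fun i => (hσ i).1)
    (subst_func_var (L := withEq L) fun i => (hσ i).2)
  refine e ▸ mp hax (ProvableIn.subst_foldr_and _ fun i => ?_)
  have e := subst_eqForm_var (L := L) (hσ i).1 (hσ i).2
  exact e ▸ h i

theorem pred_entails (p : (withEq L).Pred)
    {a b : (i : Fin ((withEq L).parity p).length) →
      Term (withEq L) (((withEq L).parity p).get i)}
    (h : ∀ i, URProvable rs (eqForm (L := L) (a i) (b i))) :
    ProvableIn (emptyPRS (withEq L)) (URset rs) {.pred p a} {.pred p b} := by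
  obtain ⟨σ, hσ⟩ := exists_subst_var_even_odd (L := withEq L) a b
  have hax := subst_of_mem (rs := rs) (A := (congrHypP p).imp _)
    (.inl <| .inl <| .inl <| .inr ⟨p, rfl⟩) σ
  have e : Form.subst σ ((Form.pred p fun i => .var (2 * i.val)).imp
      (Form.pred p fun i => .var (2 * i.val + 1))) = (Form.pred p a).imp (Form.pred p b) :=
    congrArg₂ (fun a b => (Form.pred p a).imp (Form.pred p b))
      (funext fun i => (hσ i).1) (funext fun i => (hσ i).2)
  refine ProvableIn.entails_of_imp (shiftInvariant_URset rs)
    (e ▸ mp hax (ProvableIn.subst_foldr_and _ fun i => ?_))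
  have e := subst_eqForm_var (L := L) (hσ i).1 (hσ i).2
  exact e ▸ h i

end URProvable

theorem EqE.urProvable {rs : PRS L} {s : L.Sorts} {t u : Term L s} (h : EqE rs s t u) :
    URProvable rs.toEq (eqForm (Term.toEq s t) (Term.toEq s u)) := by
  induction h with
  | base σ h =>
    have hax := URProvable.subst_of_mem (rs := rs.toEq)
      (.inl <| .inl <| .inr ⟨_, _, _, ⟨_, _, h, rfl, rfl⟩, rfl⟩)
      fun s n => Term.toEq (L := L) s (σ s n)
    exact subst_eqForm (Term.toEq_subst σ _).symm (Term.toEq_subst σ _).symm ▸ hax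
  | refl t => exact .eq_refl _
  | symm _ ih => exact ih.eq_symm
  | trans _ _ ih₁ ih₂ => exact ih₁.eq_trans ih₂
  | congr f _ ih => exact .eq_func f ih

theorem eqE_of_predArg {rs : PRS L} {p : L.Pred}
    {args args' : (i : Fin (L.parity p).length) → Term L ((L.parity p).get i)}
    {i : Fin (L.parity p).length} (h : EqE rs _ (args i) (args' i))
    (h' : ∀ j, j ≠ i → args j = args' j) (j : Fin (L.parity p).length) :
    EqE rs _ (args j) (args' j) := by
  by_cases hj : j = i
  · exact hj ▸ h
  · exact h' j hj ▸ .refl _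

mutual
  theorem RwNeg.toEq_entails {rs : PRS L} {A B : Form L} (h : RwNeg rs A B) :
      ProvableIn (emptyPRS (withEq L)) (URset rs.toEq) {A.toEq} {B.toEq} := by
    cases h with
    | predArg p args args' i h h' =>
      exact URProvable.pred_entails (.inl p) fun j => (eqE_of_predArg h h' j).urProvable
    | @rule P A σ h =>
      have hax := URProvable.subst_of_mem (rs := rs.toEq) (A := P.toEq.imp A.toEq)
        (.inl <| .inr ⟨_, _, ⟨P, A, h, rfl, rfl⟩, rfl⟩) fun s n => Term.toEq (L := L) s (σ s n)
      rw [Form.toEq_subst, Form.toEq_subst]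
      exact .entails_of_imp (shiftInvariant_URset _) hax
    | notC h => exact .not_mono h.toEq_entails
    | andL h => exact .and_mono h.toEq_entails (.entails_refl (shiftInvariant_URset _) _)
    | andR h => exact .and_mono (.entails_refl (shiftInvariant_URset _) _) h.toEq_entails
    | orL h => exact .or_mono h.toEq_entails (.entails_refl (shiftInvariant_URset _) _)
    | orR h => exact .or_mono (.entails_refl (shiftInvariant_URset _) _) h.toEq_entails
    | impL h => exact .imp_mono h.toEq_entails (.entails_refl (shiftInvariant_URset _) _)
    | impR h => exact .imp_mono (.entails_refl (shiftInvariant_URset _) _) h.toEq_entails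
    | allC h => exact .all_mono (shiftInvariant_URset _) h.toEq_entails
    | exC h => exact .ex_mono (shiftInvariant_URset _) h.toEq_entails
  theorem RwPos.toEq_entails {rs : PRS L} {A B : Form L} (h : RwPos rs A B) :
      ProvableIn (emptyPRS (withEq L)) (URset rs.toEq) {B.toEq} {A.toEq} := by
    cases h with
    | predArg p args args' i h h' =>
      exact URProvable.pred_entails (.inl p) fun j => (eqE_of_predArg h h' j).symm.urProvable
    | @rule P A σ h =>
      have hax := URProvable.subst_of_mem (rs := rs.toEq) (A := A.toEq.imp P.toEq)
        (.inr ⟨_, _, ⟨P, A, h, rfl, rfl⟩, rfl⟩) fun s n => Term.toEq (L := L) s (σ s n)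
      rw [Form.toEq_subst, Form.toEq_subst]
      exact .entails_of_imp (shiftInvariant_URset _) hax
    | notC h => exact .not_mono h.toEq_entails
    | andL h => exact .and_mono h.toEq_entails (.entails_refl (shiftInvariant_URset _) _)
    | andR h => exact .and_mono (.entails_refl (shiftInvariant_URset _) _) h.toEq_entails
    | orL h => exact .or_mono h.toEq_entails (.entails_refl (shiftInvariant_URset _) _)
    | orR h => exact .or_mono (.entails_refl (shiftInvariant_URset _) _) h.toEq_entails
    | impL h => exact .imp_mono h.toEq_entails (.entails_refl (shiftInvariant_URset _) _)
    | impR h => exact .imp_mono (.entails_refl (shiftInvariant_URset _) _) h.toEq_entails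
    | allC h => exact .all_mono (shiftInvariant_URset _) h.toEq_entails
    | exC h => exact .ex_mono (shiftInvariant_URset _) h.toEq_entails
end

theorem RwNegS.toEq_entails {rs : PRS L} {A B : Form L} (h : RwNegS rs A B) :
    ProvableIn (emptyPRS (withEq L)) (URset rs.toEq) {A.toEq} {B.toEq} := by
  induction h with
  | refl => exact .entails_refl (shiftInvariant_URset _) _
  | tail _ h ih => exact ih.entails_trans h.toEq_entails

theorem RwPosS.toEq_entails {rs : PRS L} {A B : Form L} (h : RwPosS rs A B) :
    ProvableIn (emptyPRS (withEq L)) (URset rs.toEq) {B.toEq} {A.toEq} := by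
  induction h with
  | refl => exact .entails_refl (shiftInvariant_URset _) _
  | tail _ h ih => exact h.toEq_entails.entails_trans ih

theorem Pf.provableIn_URset {rs : PRS L} {c : Bool} {n : ℕ} {Γ Δ : Multiset (Form L)}
    (h : Pf rs c n Γ Δ) :
    ProvableIn (emptyPRS (withEq L)) (URset rs.toEq) (Γ.map Form.toEq) (Δ.map Form.toEq) := by
  have hT := shiftInvariant_URset rs.toEq
  induction h with
  | ax _ h₁ h₂ => exact h₁.toEq_entails.entails_trans h₂.toEq_entails
  | cut _ h₁ h₂ _ _ ih₁ ih₂ =>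
    simp only [Multiset.map_cons] at ih₁ ih₂
    exact .cut (h₁.toEq_entails.left_of_entails ih₁) (h₂.toEq_entails.right_of_entails ih₂)
  | contrL h₁ h₂ _ ih =>
    simp only [Multiset.map_cons] at ih ⊢
    refine (h₂.toEq_entails.left_of_entails (h₁.toEq_entails.left_of_entails ih).swapL).mono ?_
      fun _ => id
    exact Multiset.cons_subset.2 ⟨Multiset.mem_cons_self _ _, fun _ => id⟩
  | contrR h₁ h₂ _ ih =>
    simp only [Multiset.map_cons] at ih ⊢
    refine (h₂.toEq_entails.right_of_entails (h₁.toEq_entails.right_of_entails ih).swapR).mono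
      (fun _ => id) ?_
    exact Multiset.cons_subset.2 ⟨Multiset.mem_cons_self _ _, fun _ => id⟩
  | weakL _ ih => rw [Multiset.map_cons]; exact ih.weakL
  | weakR _ ih => rw [Multiset.map_cons]; exact ih.weakR
  | topR h => rw [Multiset.map_cons]; exact h.toEq_entails.right_of_entails .topR
  | botL h => rw [Multiset.map_cons]; exact h.toEq_entails.left_of_entails .botL
  | notL h _ ih =>
    simp only [Multiset.map_cons] at ih ⊢
    exact h.toEq_entails.left_of_entails ih.notL
  | notR h _ ih =>
    simp only [Multiset.map_cons] at ih ⊢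
    exact h.toEq_entails.right_of_entails ih.notR
  | andL h _ ih =>
    simp only [Multiset.map_cons] at ih ⊢
    exact h.toEq_entails.left_of_entails ih.andL
  | andR h _ _ ih₁ ih₂ =>
    simp only [Multiset.map_cons] at ih₁ ih₂ ⊢
    exact h.toEq_entails.right_of_entails (ih₁.andR ih₂)
  | orL h _ _ ih₁ ih₂ =>
    simp only [Multiset.map_cons] at ih₁ ih₂ ⊢
    exact h.toEq_entails.left_of_entails (ih₁.orL ih₂)
  | orR h _ ih =>
    simp only [Multiset.map_cons] at ih ⊢
    exact h.toEq_entails.right_of_entails ih.orR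
  | impL h _ _ ih₁ ih₂ =>
    simp only [Multiset.map_cons] at ih₁ ih₂ ⊢
    exact h.toEq_entails.left_of_entails (ih₁.impL ih₂)
  | impR h _ ih =>
    simp only [Multiset.map_cons] at ih ⊢
    exact h.toEq_entails.right_of_entails ih.impR
  | @allL _ _ s t _ B _ _ h₁ h₂ _ ih =>
    rw [Multiset.map_cons] at ih ⊢
    have := h₂.toEq_entails.left_of_entails ih
    rw [Form.toEq_inst] at this
    exact h₁.toEq_entails.left_of_entails (.allL (L := withEq L) _ this)
  | @allR _ _ s _ _ _ h _ ih =>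
    rw [Multiset.map_cons, Multiset.map_toEq_shift, Multiset.map_toEq_shift] at ih
    rw [Multiset.map_cons]
    exact h.toEq_entails.right_of_entails (.allR (L := withEq L) hT ih)
  | @exL _ _ s _ _ _ h _ ih =>
    rw [Multiset.map_cons, Multiset.map_toEq_shift, Multiset.map_toEq_shift] at ih
    rw [Multiset.map_cons]
    exact h.toEq_entails.left_of_entails (.exL (L := withEq L) hT ih)
  | @exR _ _ s t _ B _ _ h₁ h₂ _ ih =>
    rw [Multiset.map_cons] at ih ⊢
    have := h₂.toEq_entails.right_of_entails ih
    rw [Form.toEq_inst] at this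
    exact h₁.toEq_entails.right_of_entails (.exR (L := withEq L) _ this)

/-- A sequent `Γ ⊢ Δ` of `L` is provable modulo `R` if and
only if it is provable in predicate logic from the axioms `U_R` (stated in the
language `L'` obtained by adding an equality symbol in each sort). -/
theorem provable_modulo_iff_provable_from_UR (L : Language) (rs : PRS L)
    (Γ Δ : Multiset (Form L)) :
    Provable rs Γ Δ ↔
      PLProvableIn (URset rs.toEq) (Γ.map Form.toEq) (Δ.map Form.toEq) := by
  exact ⟨fun ⟨_, h⟩ => h.provableIn_URset, provable_of_provable_from_UR⟩

end
end PDM
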